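/- arXiv:1512.03228 — 4 statements merged into one kernel-verified Lean document; each statement's English description precedes it below -/
import Mathlib

section
/- Let β = 1. For every f ∈ L¹(I₁): (a) if ∫_{−1}^{1} f(t) dt = 0, then ‖T₁^N f‖_{L¹(I₁)} → 0 as N → +∞; (b) for every η with 0 < η < 1 (and arbitrary f ∈ L¹(I₁)), ∫_{−η}^{η} |T₁^N f(x)| dx → 0 as N → +∞. -/
open MeasureTheory Set Filter

/-- The subtransfer operator `T_β f(x) = ∑_{j∈ℤ, j≠0} (β/(x+2j)²) f(-β/(x+2j))`. -/
noncomputable def Tsub (β : ℝ) (f : ℝ → ℝ) (x : ℝ) : ℝ :=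
  ∑' j : {j : ℤ // j ≠ 0},
    (β / (x + 2 * ((j : ℤ) : ℝ)) ^ 2) * f (-β / (x + 2 * ((j : ℤ) : ℝ)))

open scoped Topology

section Abstract

variable {E : Type*} [NormedAddCommGroup E] [NormedSpace ℝ E]

/-- A bounded nonnegative subharmonic function of a Markov chain on `ℕ` with a proper Lyapunov
function `V` vanishing at `0` is at most its value at `0`. -/
theorem le_apply_zero_of_subharmonic {P : ℕ → ℕ → ℝ} {V φ : ℕ → ℝ} {M : ℝ}
    (hP : ∀ k i, 0 ≤ P k i) (hPpos : ∀ k, ∃ᶠ i in atTop, 0 < P k i)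
    (hPs : ∀ k, Summable (P k)) (hP1 : ∀ k, ∑' i, P k i ≤ 1)
    (hV0 : V 0 = 0) (hVtop : Tendsto V atTop atTop)
    (hVs : ∀ k, k ≠ 0 → Summable fun i => P k i * V i)
    (hPV : ∀ k, k ≠ 0 → ∑' i, P k i * V i ≤ V k)
    (hφ0 : ∀ k, 0 ≤ φ k) (hφM : ∀ k, φ k ≤ M)
    (hφ : ∀ k, φ k ≤ ∑' i, P k i * φ i) (k : ℕ) : φ k ≤ φ 0 := by
  have hφs : ∀ k, Summable fun i => P k i * φ i := fun k =>
    Summable.of_nonneg_of_le (fun i => mul_nonneg (hP k i) (hφ0 i))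
      (fun i => mul_le_mul_of_nonneg_left (hφM i) (hP k i)) ((hPs k).mul_right M)
  have key : ∀ ε : ℝ, 0 < ε → φ k - ε * V k ≤ φ 0 := by
    intro ε hε
    set ψ : ℕ → ℝ := fun i => φ i - ε * V i with hψ
    have hψbot : Tendsto ψ atTop atBot := by
      have h1 : Tendsto (fun i => M - ε * V i) atTop atBot := by
        have := tendsto_neg_atTop_atBot.comp (hVtop.const_mul_atTop hε)
        simpa [sub_eq_add_neg] using tendsto_atBot_add_const_left atTop M this
      exact tendsto_atBot_mono (fun i => sub_le_sub_right (hφM i) _) h1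
    have hψ0 : ψ 0 = φ 0 := by simp [hψ, hV0]
    obtain ⟨m, hm⟩ : ∃ m, ∀ i, ψ i ≤ ψ m := by
      have hcof : Tendsto ψ (cocompact ℕ) atBot := by
        simpa [cocompact_eq_cofinite, Nat.cofinite_eq_atTop] using hψbot
      exact (continuous_of_discreteTopology (f := ψ)).exists_forall_ge hcof
    have hm0 : 0 ≤ ψ m := (hφ0 0).trans (hψ0 ▸ hm 0)
    by_cases h0 : m = 0
    · rw [h0, hψ0] at hm
      exact hm k
    exfalso
    obtain ⟨i, hiP, hi⟩ := ((hPpos m).and_eventually (hψbot.eventually_lt_atBot 0)).exists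
    have hsψ : Summable fun i => P m i * ψ i := by
      refine ((hφs m).sub ((hVs m h0).mul_left ε)).congr fun j => ?_
      change _ = P m j * (φ j - ε * V j)
      ring
    have h1 : ∑' i, P m i * ψ i < ∑' i, P m i * ψ m :=
      Summable.tsum_lt_tsum (i := i)
        (fun j => mul_le_mul_of_nonneg_left (hm j) (hP m j))
        (mul_lt_mul_of_pos_left (hi.trans_le hm0) hiP) hsψ ((hPs m).mul_right _)
    have h2 : ∑' i, P m i * ψ i = ∑' i, P m i * φ i - ε * ∑' i, P m i * V i := by
      rw [← tsum_mul_left, ← (hφs m).tsum_sub ((hVs m h0).mul_left ε)]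
      refine tsum_congr fun j => ?_
      simp only [hψ]; ring
    rw [tsum_mul_right] at h1
    have h3 := hφ m
    have h4 := mul_le_mul_of_nonneg_left (hPV m h0) hε.le
    have h5 := mul_le_mul_of_nonneg_right (hP1 m) hm0
    have h6 : ψ m = φ m - ε * V m := rfl
    linarith
  have hlim : Tendsto (fun ε : ℝ => φ k - ε * V k) (𝓝[>] 0) (𝓝 (φ k - 0 * V k)) :=
    ((continuous_const.sub (continuous_id.mul continuous_const)).tendsto 0).mono_left
      nhdsWithin_le_nhds
  rw [zero_mul, sub_zero] at hlim
  exact le_of_tendsto hlim (eventually_mem_nhdsWithin.mono fun ε hε => key ε hε)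

/-- For a contraction `T`, the asymptotic norm `lim ‖T ^ n x‖`. -/
noncomputable def asympNorm (T : E →L[ℝ] E) (x : E) : ℝ := ⨅ n : ℕ, ‖(T ^ n) x‖

variable {T : E →L[ℝ] E}

theorem tendsto_asympNorm (hT : ∀ x, ‖T x‖ ≤ ‖x‖) (x : E) :
    Tendsto (fun n : ℕ => ‖(T ^ n) x‖) atTop (𝓝 (asympNorm T x)) := by
  refine tendsto_atTop_ciInf (antitone_nat_of_succ_le fun n => ?_)
    ⟨0, by rintro _ ⟨n, rfl⟩; exact norm_nonneg _⟩
  rw [pow_succ']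
  exact hT _

theorem asympNorm_nonneg (x : E) : 0 ≤ asympNorm T x := Real.iInf_nonneg fun _ => norm_nonneg _

theorem asympNorm_le_norm (x : E) : asympNorm T x ≤ ‖x‖ :=
  ciInf_le_of_le ⟨0, by rintro _ ⟨n, rfl⟩; exact norm_nonneg _⟩ 0 (by simp)

theorem asympNorm_add_le (hT : ∀ x, ‖T x‖ ≤ ‖x‖) (x y : E) :
    asympNorm T (x + y) ≤ asympNorm T x + asympNorm T y :=
  le_of_tendsto_of_tendsto' (tendsto_asympNorm hT _)
    ((tendsto_asympNorm hT x).add (tendsto_asympNorm hT y))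
    fun n => by rw [map_add]; exact norm_add_le _ _

theorem asympNorm_smul (hT : ∀ x, ‖T x‖ ≤ ‖x‖) (c : ℝ) (x : E) :
    asympNorm T (c • x) = |c| * asympNorm T x :=
  tendsto_nhds_unique (tendsto_asympNorm hT _)
    (((tendsto_asympNorm hT x).const_mul |c|).congr fun n => by
      rw [map_smul, norm_smul, Real.norm_eq_abs])

theorem asympNorm_apply (hT : ∀ x, ‖T x‖ ≤ ‖x‖) (x : E) : asympNorm T (T x) = asympNorm T x :=
  tendsto_nhds_unique (tendsto_asympNorm hT _)
    (((tendsto_add_atTop_iff_nat 1).2 (tendsto_asympNorm hT x)).congr fun n => by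
      rw [pow_succ]; rfl)

theorem asympNorm_zero : asympNorm T 0 = 0 :=
  le_antisymm (by simpa using asympNorm_le_norm (T := T) 0) (asympNorm_nonneg _)

theorem asympNorm_sum_le (hT : ∀ x, ‖T x‖ ≤ ‖x‖) {ι : Type*} (s : Finset ι) (f : ι → E) :
    asympNorm T (∑ i ∈ s, f i) ≤ ∑ i ∈ s, asympNorm T (f i) :=
  Finset.le_sum_of_subadditive _ asympNorm_zero.le (asympNorm_add_le hT) s f

theorem continuous_asympNorm (hT : ∀ x, ‖T x‖ ≤ ‖x‖) : Continuous (asympNorm T) := by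
  refine (LipschitzWith.of_le_add fun x y => ?_ : LipschitzWith 1 (asympNorm T)).continuous
  have h := asympNorm_add_le hT y (x - y)
  rw [add_sub_cancel] at h
  rw [dist_eq_norm]
  exact h.trans (by gcongr; exact asympNorm_le_norm _)

theorem asympNorm_le_tsum (hT : ∀ x, ‖T x‖ ≤ ‖x‖) {a : ℕ → ℝ} {x : ℕ → E} {y : E}
    (ha : ∀ i, 0 ≤ a i) (hs : Summable fun i => a i * asympNorm T (x i))
    (h : HasSum (fun i => a i • x i) y) : asympNorm T y ≤ ∑' i, a i * asympNorm T (x i) := by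
  refine le_of_tendsto_of_tendsto' ((continuous_asympNorm hT).continuousAt.tendsto.comp h)
    hs.hasSum fun s => (asympNorm_sum_le hT s _).trans_eq ?_
  exact Finset.sum_congr rfl fun i _ => by rw [asympNorm_smul hT, abs_of_nonneg (ha i)]

/-- A supporting functional for the asymptotic norm. -/
theorem exists_dual_asympNorm (hT : ∀ x, ‖T x‖ ≤ ‖x‖) (y : E) :
    ∃ l : E →L[ℝ] ℝ, l y = asympNorm T y ∧ ∀ x, l x ≤ asympNorm T x := by
  by_cases hy : y = 0
  · exact ⟨0, by simp [hy, asympNorm_zero], fun x => by simpa using asympNorm_nonneg x⟩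
  obtain ⟨g, hg, hgle⟩ := exists_extension_of_le_sublinear
    (LinearPMap.mkSpanSingleton (K := ℝ) y (asympNorm T y) hy) (asympNorm T)
    (fun c hc x => by rw [asympNorm_smul hT, abs_of_pos hc]) (asympNorm_add_le hT) (by
      rintro ⟨x, hx⟩
      obtain ⟨c, rfl⟩ := Submodule.mem_span_singleton.1 hx
      rw [LinearPMap.mkSpanSingleton'_apply, asympNorm_smul hT]
      exact mul_le_mul_of_nonneg_right (le_abs_self c) (asympNorm_nonneg _))
  refine ⟨g.mkContinuous 1 fun x => ?_, ?_, fun x => hgle x⟩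
  · rw [one_mul, Real.norm_eq_abs, abs_le']
    refine ⟨(hgle x).trans (asympNorm_le_norm x), ?_⟩
    rw [← map_neg]
    simpa using (hgle (-x)).trans (asympNorm_le_norm (-x))
  · exact (hg ⟨y, Submodule.mem_span_singleton_self y⟩).trans
      (LinearPMap.mkSpanSingleton_apply ℝ ℝ hy _)

/-- Let `T` be a contraction acting on the vectors `e k` as a Markov chain on `ℕ` which preserves
parity, is irreducible and conservative on the even states, and admits a Lyapunov function.
Then `T ^ n (e k)` is asymptotic to `T ^ n (e 0)` for even `k`, and to `0` for odd `k`. -/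
theorem asympNorm_sub_eq_zero (hT : ∀ x, ‖T x‖ ≤ ‖x‖) {e : ℕ → E} (he : ∀ k, ‖e k‖ ≤ 1)
    {P : ℕ → ℕ → ℝ} {V : ℕ → ℝ} (hP : ∀ k i, 0 ≤ P k i)
    (hPpos : ∀ k i, Even (k + i) → 0 < P k i) (hPzero : ∀ k i, ¬ Even (k + i) → P k i = 0)
    (hPs : ∀ k, Summable (P k)) (hP1 : ∀ k, ∑' i, P k i ≤ 1)
    (hPeven : ∀ k, Even k → ∑' i, P k i = 1)
    (hV0 : V 0 = 0) (hVtop : Tendsto V atTop atTop)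
    (hVs : ∀ k, k ≠ 0 → Summable fun i => P k i * V i)
    (hPV : ∀ k, k ≠ 0 → ∑' i, P k i * V i ≤ V k)
    (hTe : ∀ k, HasSum (fun i => P k i • e i) (T (e k))) (k : ℕ) :
    asympNorm T (e k - (if Even k then (1 : ℝ) else 0) • e 0) = 0 := by
  have hfreq : ∀ k, ∃ᶠ i in atTop, 0 < P k i := fun k => frequently_atTop.2 fun N =>
    ⟨k + 2 * N, by omega, hPpos _ _ ⟨k + N, by ring⟩⟩
  have hsum : ∀ k (x : ℕ → E), (∀ i, ‖x i‖ ≤ 2) →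
      Summable fun i => P k i * asympNorm T (x i) := fun k x hx =>
    Summable.of_nonneg_of_le (fun i => mul_nonneg (hP k i) (asympNorm_nonneg _))
      (fun i => mul_le_mul_of_nonneg_left ((asympNorm_le_norm _).trans (hx i)) (hP k i))
      ((hPs k).mul_right 2)
  have hmax := fun (φ : ℕ → ℝ) h0 hM hφ => le_apply_zero_of_subharmonic (φ := φ) (M := 2) hP hfreq
    hPs hP1 hV0 hVtop hVs hPV h0 hM hφ
  -- the increments `e k - T (e k)`
  have hbd : ∀ k, ‖e k - T (e k)‖ ≤ 2 := fun k =>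
    (norm_sub_le _ _).trans (by linarith [he k, (hT (e k)).trans (he k)])
  have hDsum : ∀ k, HasSum (fun i => P k i • (e i - T (e i))) (T (e k) - T (T (e k))) := by
    intro k
    have h2 := T.hasSum (hTe k)
    simp only [map_smul] at h2
    simpa only [smul_sub] using (hTe k).sub h2
  have hDle : ∀ k, asympNorm T (e k - T (e k)) ≤ asympNorm T (e 0 - T (e 0)) := by
    refine hmax _ (fun k => asympNorm_nonneg _) (fun k => (asympNorm_le_norm _).trans (hbd k))
      fun k => ?_
    rw [← asympNorm_apply hT, map_sub]
    exact asympNorm_le_tsum hT (hP k) (hsum k _ hbd) (hDsum k)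
  have hD0 : asympNorm T (e 0 - T (e 0)) = 0 := by
    set α := asympNorm T (e 0 - T (e 0)) with hα
    obtain ⟨l, hl, hle⟩ := exists_dual_asympNorm hT (T (e 0) - T (T (e 0)))
    rw [← map_sub, asympNorm_apply hT, ← hα] at hl
    have hlD : ∀ k, HasSum (fun i => P k i * l (e i - T (e i))) (l (T (e k) - T (T (e k)))) := by
      intro k
      simpa using l.hasSum (hDsum k)
    have hleα : ∀ i, l (e i - T (e i)) ≤ α := fun i => (hle _).trans (hDle i)
    have hleven : ∀ i, Even i → l (e i - T (e i)) = α := by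
      intro i hi
      refine le_antisymm (hleα i) (not_lt.1 fun hlt => ?_)
      have h1 := Summable.tsum_lt_tsum (i := i)
        (fun j => mul_le_mul_of_nonneg_left (hleα j) (hP 0 j))
        (mul_lt_mul_of_pos_left hlt (hPpos 0 i (by simpa using hi))) (hlD 0).summable
        ((hPs 0).mul_right _)
      rw [(hlD 0).tsum_eq, tsum_mul_right, hPeven 0 (by simp), one_mul, ← map_sub, hl] at h1
      exact lt_irrefl _ h1
    let W : Submodule ℝ E := (Submodule.span ℝ (e '' {i | Even i})).topologicalClosure
    have heW : ∀ i, Even i → e i ∈ W := fun i hi =>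
      Submodule.le_topologicalClosure _ (Submodule.subset_span ⟨i, hi, rfl⟩)
    have hWcl : IsClosed (W : Set E) := Submodule.isClosed_topologicalClosure _
    have hWind : ∀ K : Submodule ℝ E, IsClosed (K : Set E) → (∀ i, Even i → e i ∈ K) → W ≤ K := by
      intro K hK h
      refine Submodule.topologicalClosure_minimal _ (Submodule.span_le.2 ?_) hK
      rintro _ ⟨i, hi, rfl⟩
      exact h i hi
    have hWT : W ≤ W.comap (T : E →ₗ[ℝ] E) := by
      refine hWind _ (hWcl.preimage T.continuous) fun i hi => ?_
      refine hWcl.mem_of_tendsto (hTe i) (Eventually.of_forall fun s => ?_)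
      refine W.sum_mem fun j _ => ?_
      by_cases hj : Even j
      · exact W.smul_mem _ (heW j hj)
      · rw [hPzero i j (by simp [Nat.even_add, hi, hj]), zero_smul]
        exact W.zero_mem
    let L : E →L[ℝ] ℝ := l.comp (ContinuousLinearMap.id ℝ E - T)
    have hL : ∀ x, L x = l (x - T x) := fun x => rfl
    have hWL : W ≤ (L - L.comp T : E →L[ℝ] ℝ).ker := by
      refine hWind _ (ContinuousLinearMap.isClosed_ker _) fun i hi => ?_
      have h1 : L (T (e i)) = α := by
        rw [hL, ← (hlD i).tsum_eq, ← one_mul α, ← hPeven i hi, ← tsum_mul_right]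
        refine tsum_congr fun j => ?_
        by_cases hj : Even j
        · rw [hleven j hj]
        · rw [hPzero i j (by simp [Nat.even_add, hi, hj]), zero_mul, zero_mul]
      have h2 : L (e i) = α := hleven i hi
      simp [h1, h2]
    have hpowW : ∀ n : ℕ, (T ^ n) (e 0) ∈ W ∧ L ((T ^ n) (e 0)) = α := by
      intro n
      induction n with
      | zero => exact ⟨heW 0 (by simp), hleven 0 (by simp)⟩
      | succ n ih =>
        rw [pow_succ']
        refine ⟨hWT ih.1, ?_⟩
        have := hWL ih.1
        simp only [LinearMap.mem_ker] at this
        have h3 : L ((T ^ n) (e 0)) - L (T ((T ^ n) (e 0))) = 0 := this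
        rw [ih.2] at h3
        exact (sub_eq_zero.1 h3).symm
    have htel : ∀ n : ℕ, l (e 0 - (T ^ n) (e 0)) = n * α := by
      intro n
      induction n with
      | zero => simp
      | succ n ih =>
        have h4 := (hpowW n).2
        rw [hL, map_sub] at h4
        rw [map_sub] at ih ⊢
        have h5 : (T ^ (n + 1)) (e 0) = T ((T ^ n) (e 0)) := by rw [pow_succ']; rfl
        rw [h5, Nat.cast_succ]
        linarith
    have hpow1 : ∀ n : ℕ, ‖(T ^ n) (e 0)‖ ≤ 1 := by
      intro n
      induction n with
      | zero => simpa using he 0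
      | succ n ih => rw [pow_succ']; exact (hT _).trans ih
    have hb : ∀ n : ℕ, (n : ℝ) * α ≤ 2 := fun n => by
      rw [← htel n]
      refine (hle _).trans ((asympNorm_le_norm _).trans ((norm_sub_le _ _).trans ?_))
      linarith [he 0, hpow1 n]
    by_contra hne
    have hpos : 0 < α := lt_of_le_of_ne (asympNorm_nonneg _) (Ne.symm hne)
    obtain ⟨n, hn⟩ := exists_nat_gt (2 / α)
    rw [div_lt_iff₀ hpos] at hn
    exact absurd (hb n) (not_le.2 hn)
  -- the differences `e k - c k • e 0`
  set c : ℕ → ℝ := fun k => if Even k then 1 else 0 with hc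
  have hc01 : ∀ k, |c k| ≤ 1 := fun k => by by_cases h : Even k <;> simp [hc, h]
  have hcbd : ∀ k, ‖e k - c k • e 0‖ ≤ 2 := fun k => by
    refine (norm_sub_le _ _).trans ?_
    rw [norm_smul, Real.norm_eq_abs]
    nlinarith [he k, he 0, hc01 k, norm_nonneg (e 0), abs_nonneg (c k)]
  have hPc : ∀ k, HasSum (fun i => P k i * c i) (c k) := by
    intro k
    by_cases hk : Even k
    · have h1 : (fun i => P k i * c i) = P k := by
        ext i
        by_cases hi : Even i
        · simp [hc, hi]
        · simp [hPzero k i (by simp [Nat.even_add, hi, hk])]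
      rw [h1, show c k = ∑' i, P k i by rw [hPeven k hk]; simp [hc, hk]]
      exact (hPs k).hasSum
    · have h1 : (fun i => P k i * c i) = fun _ => 0 := by
        ext i
        by_cases hi : Even i
        · simp [hPzero k i (by simp [Nat.even_add, hi, hk])]
        · simp [hc, hi]
      rw [h1, show c k = 0 by simp [hc, hk]]
      exact hasSum_zero
  have hfin : asympNorm T (e k - c k • e 0) ≤ asympNorm T (e 0 - c 0 • e 0) := by
    refine hmax (fun k => asympNorm T (e k - c k • e 0)) (fun k => asympNorm_nonneg _)
      (fun k => (asympNorm_le_norm _).trans (hcbd k)) (fun k => ?_) k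
    have h1 : HasSum (fun i => P k i • (e i - c i • e 0)) (T (e k) - c k • e 0) := by
      simpa only [smul_sub, smul_smul] using (hTe k).sub ((hPc k).smul_const (e 0))
    have h2 := asympNorm_le_tsum hT (hP k) (hsum k _ hcbd) h1
    refine le_trans ?_ h2
    rw [← asympNorm_apply hT, map_sub, map_smul]
    have h3 := asympNorm_add_le hT (T (e k) - c k • e 0) (c k • (e 0 - T (e 0)))
    rw [asympNorm_smul hT, hD0, mul_zero, add_zero, smul_sub, sub_add_sub_cancel] at h3
    exact h3
  refine le_antisymm (hfin.trans_eq ?_) (asympNorm_nonneg _)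
  simp [hc, asympNorm_zero]

end Abstract

section Coefficients

/-- Exchanging the order of summation in an absolutely summable double series. -/
theorem hasSum_tsum_swap {v : ℕ → ℕ → ℝ} {A : ℕ → ℝ}
    (hs : Summable fun p : ℕ × ℕ => v p.1 p.2) (h : ∀ j, HasSum (v j) (A j)) :
    HasSum (fun i => ∑' j, v j i) (∑' j, A j) := by
  have h1 : HasSum A (∑' p : ℕ × ℕ, v p.1 p.2) := hs.hasSum.prod_fiberwise h
  have h2 : Summable fun p : ℕ × ℕ => v p.2 p.1 := hs.prod_symm
  have h3 : ∑' p : ℕ × ℕ, v p.2 p.1 = ∑' p : ℕ × ℕ, v p.1 p.2 :=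
    (Equiv.prodComm ℕ ℕ).tsum_eq fun p : ℕ × ℕ => v p.1 p.2
  rw [h1.tsum_eq, ← h3]
  exact h2.hasSum.prod_fiberwise fun i => (h2.prod_factor i).hasSum

theorem summable_prod_of_hasSum {u : ℕ → ℕ → ℝ} {A : ℕ → ℝ} (h0 : ∀ j i, 0 ≤ u j i)
    (h : ∀ j, HasSum (u j) (A j)) (hA : Summable A) : Summable fun p : ℕ × ℕ => u p.1 p.2 :=
  (summable_prod_of_nonneg fun p => h0 p.1 p.2).2
    ⟨fun j => (h j).summable, hA.congr fun j => (h j).tsum_eq.symm⟩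

theorem hasSum_inv_pow_sub_inv_pow {p : ℕ} (hp : p ≠ 0) :
    HasSum (fun j : ℕ => ((2 * (j + 1) - 1 : ℝ)⁻¹) ^ p - ((2 * (j + 1) + 1 : ℝ)⁻¹) ^ p) 1 := by
  have hnn : ∀ j : ℕ, 0 ≤ ((2 * (j + 1) - 1 : ℝ)⁻¹) ^ p - ((2 * (j + 1) + 1 : ℝ)⁻¹) ^ p := by
    intro j
    have hj : (0 : ℝ) < 2 * (j + 1) - 1 := by have := j.cast_nonneg (α := ℝ); linarith
    rw [sub_nonneg]
    gcongr
    linarith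
  rw [hasSum_iff_tendsto_nat_of_nonneg hnn]
  have h1 : ∀ n : ℕ, ∑ j ∈ Finset.range n,
      (((2 * (j + 1) - 1 : ℝ)⁻¹) ^ p - ((2 * (j + 1) + 1 : ℝ)⁻¹) ^ p)
        = 1 - ((2 * n + 1 : ℝ)⁻¹) ^ p := by
    intro n
    have := Finset.sum_range_sub' (fun j : ℕ => ((2 * j + 1 : ℝ)⁻¹) ^ p) n
    simp only [Nat.cast_zero, mul_zero, zero_add, inv_one, one_pow] at this
    rw [← this]
    refine Finset.sum_congr rfl fun j _ => ?_
    push_cast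
    ring_nf
  simp_rw [h1]
  have h2 : Tendsto (fun n : ℕ => ((2 * n + 1 : ℝ)⁻¹) ^ p) atTop (𝓝 (0 ^ p)) := by
    refine Tendsto.pow (tendsto_inv_atTop_zero.comp ?_) p
    exact tendsto_atTop_add_const_right _ _
      (tendsto_natCast_atTop_atTop.const_mul_atTop two_pos)
  rw [zero_pow hp] at h2
  simpa using h2.const_sub 1

/-- The contribution of the two branches `±(j + 1)` of the operator `T₁` to its matrix
coefficients. -/
noncomputable def branchCoeff (k j i : ℕ) : ℝ :=
  (1 + (-1) ^ (k + i)) * (k + i + 1).choose (i + 1) * ((2 * (j + 1) : ℝ)⁻¹) ^ (k + i + 2)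

/-- The matrix coefficients of `T₁` in the basis of normalised monomials. -/
noncomputable def transCoeff (k i : ℕ) : ℝ := ∑' j, branchCoeff k j i

theorem branchCoeff_nonneg (k j i : ℕ) : 0 ≤ branchCoeff k j i := by
  have : (0 : ℝ) ≤ 1 + (-1) ^ (k + i) := by
    rcases neg_one_pow_eq_or ℝ (k + i) with h | h <;> rw [h] <;> norm_num
  unfold branchCoeff
  positivity

theorem hasSum_branchCoeff (k j : ℕ) :
    HasSum (branchCoeff k j) (((2 * (j + 1) - 1 : ℝ)⁻¹) ^ (k + 1) - ((2 * (j + 1) : ℝ)⁻¹) ^ (k + 1)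
      + (-1) ^ k * (((2 * (j + 1) : ℝ)⁻¹) ^ (k + 1) - ((2 * (j + 1) + 1 : ℝ)⁻¹) ^ (k + 1))) := by
  set a : ℝ := 2 * (j + 1) with ha
  have ha2 : 2 ≤ a := by have := j.cast_nonneg (α := ℝ); rw [ha]; linarith
  have key : ∀ r : ℝ, |r| < 1 → HasSum (fun i : ℕ => ((k + i + 1).choose (i + 1) : ℝ) * r ^ (i + 1))
      (((1 - r)⁻¹) ^ (k + 1) - 1) := by
    intro r hr
    have h := hasSum_choose_mul_geometric_of_norm_lt_one k (r := r) hr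
    rw [← hasSum_nat_add_iff' 1] at h
    simp only [Finset.range_one, Finset.sum_singleton, zero_add, Nat.choose_self, Nat.cast_one,
      pow_zero, mul_one, one_div, ← inv_pow] at h
    refine h.congr_fun fun i => ?_
    rw [Nat.choose_symm_of_eq_add (show k + i + 1 = i + 1 + k by ring),
      show k + i + 1 = i + 1 + k by ring]
  have ha1 : |a⁻¹| < 1 := by
    rw [abs_of_pos (by positivity)]
    exact inv_lt_one_of_one_lt₀ (by linarith)
  have h1 := (key a⁻¹ ha1).mul_left (a⁻¹ ^ (k + 1))
  have h2 := (key (-a⁻¹) (by rwa [abs_neg])).mul_left ((-1) ^ k * a⁻¹ ^ (k + 1))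
  have e1 : a⁻¹ * (1 - a⁻¹)⁻¹ = (a - 1)⁻¹ := by
    rw [← mul_inv]; congr 1; field_simp
  have e2 : a⁻¹ * (1 - -a⁻¹)⁻¹ = (a + 1)⁻¹ := by
    rw [← mul_inv]; congr 1; field_simp; ring
  have h3 := h1.sub h2
  rw [mul_sub, mul_sub, mul_one, mul_one, mul_assoc, ← mul_pow, ← mul_pow, e1, e2] at h3
  have hval : (a - 1)⁻¹ ^ (k + 1) - a⁻¹ ^ (k + 1) +
      (-1) ^ k * (a⁻¹ ^ (k + 1) - (a + 1)⁻¹ ^ (k + 1)) = (a - 1)⁻¹ ^ (k + 1) - a⁻¹ ^ (k + 1) -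
      ((-1) ^ k * (a + 1)⁻¹ ^ (k + 1) - (-1) ^ k * a⁻¹ ^ (k + 1)) := by ring
  rw [hval]
  refine h3.congr_fun fun i => ?_
  rw [branchCoeff, ← ha, neg_pow a⁻¹]
  ring

theorem hasSum_branchCoeff_mul_pow (k j : ℕ) {x : ℝ} (hx : |x| ≤ 1) :
    HasSum (fun i : ℕ => branchCoeff k j i * (i + 1) * x ^ i)
      ((k + 1) * (((2 * (j + 1) - x : ℝ)⁻¹) ^ (k + 2) +
        (-1) ^ k * ((2 * (j + 1) + x : ℝ)⁻¹) ^ (k + 2))) := by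
  set a : ℝ := 2 * (j + 1) with ha
  have ha2 : 2 ≤ a := by have := j.cast_nonneg (α := ℝ); rw [ha]; linarith
  have ha0 : a ≠ 0 := by linarith
  have hax : |a⁻¹ * x| < 1 := by
    rw [abs_mul, abs_of_pos (show 0 < a⁻¹ by positivity)]
    have : a⁻¹ < 1 := inv_lt_one_of_one_lt₀ (by linarith)
    have h0 : 0 < a⁻¹ := by positivity
    nlinarith [abs_nonneg x]
  have key : ∀ r : ℝ, |r| < 1 → HasSum (fun i : ℕ => ((i + (k + 1)).choose (k + 1) : ℝ) * r ^ i)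
      (((1 - r)⁻¹) ^ (k + 2)) := by
    intro r hr
    simpa [← inv_pow] using hasSum_choose_mul_geometric_of_norm_lt_one (k + 1) (r := r) hr
  have h1 := (key (a⁻¹ * x) hax).mul_left ((k + 1) * a⁻¹ ^ (k + 2))
  have h2 := (key (-(a⁻¹ * x)) (by rwa [abs_neg])).mul_left ((-1) ^ k * (k + 1) * a⁻¹ ^ (k + 2))
  have e1 : a⁻¹ * (1 - a⁻¹ * x)⁻¹ = (a - x)⁻¹ := by
    rw [← mul_inv]; congr 1; field_simp
  have e2 : a⁻¹ * (1 - -(a⁻¹ * x))⁻¹ = (a + x)⁻¹ := by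
    rw [← mul_inv]; congr 1; field_simp; ring
  have h3 := h1.add h2
  have hval : (k + 1) * ((a - x)⁻¹ ^ (k + 2) + (-1) ^ k * (a + x)⁻¹ ^ (k + 2)) =
      (k + 1) * a⁻¹ ^ (k + 2) * (1 - a⁻¹ * x)⁻¹ ^ (k + 2) +
        (-1) ^ k * (k + 1) * a⁻¹ ^ (k + 2) * (1 - -(a⁻¹ * x))⁻¹ ^ (k + 2) := by
    rw [← e1, ← e2, mul_pow, mul_pow]
    ring
  rw [hval]
  refine h3.congr_fun fun i => ?_
  have hch : ((k + i + 1).choose (i + 1) : ℝ) * (i + 1) =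
      (k + 1) * (i + (k + 1)).choose (k + 1) := by
    have h4 := Nat.choose_succ_right_eq (k + i + 1) i
    rw [show k + i + 1 - i = k + 1 by omega,
      Nat.choose_symm_of_eq_add (show k + i + 1 = i + (k + 1) by ring)] at h4
    rw [show i + (k + 1) = k + i + 1 by ring, mul_comm ((k : ℝ) + 1)]
    exact_mod_cast h4
  rw [branchCoeff, ← ha, neg_pow (a⁻¹ * x)]
  calc (1 + (-1) ^ (k + i)) * ((k + i + 1).choose (i + 1) : ℝ) * a⁻¹ ^ (k + i + 2) * (i + 1) * x ^ i
      = (1 + (-1) ^ (k + i)) * (((k + i + 1).choose (i + 1) : ℝ) * (i + 1)) * a⁻¹ ^ (k + i + 2)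
        * x ^ i := by ring
    _ = _ := by rw [hch]; ring

theorem inv_pow_bounds (j p : ℕ) :
    0 ≤ ((2 * (j + 1) + 1 : ℝ)⁻¹) ^ p ∧
    ((2 * (j + 1) + 1 : ℝ)⁻¹) ^ p ≤ ((2 * (j + 1) : ℝ)⁻¹) ^ p ∧
    ((2 * (j + 1) : ℝ)⁻¹) ^ p ≤ ((2 * (j + 1) - 1 : ℝ)⁻¹) ^ p := by
  have hj : (0 : ℝ) < 2 * (j + 1) - 1 := by have := j.cast_nonneg (α := ℝ); linarith
  refine ⟨by positivity, ?_, ?_⟩ <;> gcongr <;> linarith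

theorem summable_branchCoeff_prod (k : ℕ) :
    Summable fun p : ℕ × ℕ => branchCoeff k p.1 p.2 := by
  refine summable_prod_of_hasSum (branchCoeff_nonneg k) (hasSum_branchCoeff k)
    (Summable.of_nonneg_of_le (fun j => (hasSum_branchCoeff k j).nonneg (branchCoeff_nonneg k j))
      (fun j => ?_) (hasSum_inv_pow_sub_inv_pow k.succ_ne_zero).summable)
  obtain ⟨h1, h2, h3⟩ := inv_pow_bounds j (k + 1)
  rcases neg_one_pow_eq_or ℝ k with h | h <;> rw [h] <;> simp only [Nat.succ_eq_add_one] <;>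
    linarith

theorem hasSum_transCoeff (k : ℕ) : HasSum (transCoeff k)
    (∑' j : ℕ, (((2 * (j + 1) - 1 : ℝ)⁻¹) ^ (k + 1) - ((2 * (j + 1) : ℝ)⁻¹) ^ (k + 1)
      + (-1) ^ k * (((2 * (j + 1) : ℝ)⁻¹) ^ (k + 1) - ((2 * (j + 1) + 1 : ℝ)⁻¹) ^ (k + 1)))) :=
  hasSum_tsum_swap (summable_branchCoeff_prod k) (hasSum_branchCoeff k)

theorem tsum_transCoeff_of_even {k : ℕ} (hk : Even k) : ∑' i, transCoeff k i = 1 := by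
  rw [(hasSum_transCoeff k).tsum_eq]
  refine Eq.trans ?_ (hasSum_inv_pow_sub_inv_pow k.succ_ne_zero).tsum_eq
  refine tsum_congr fun j => ?_
  rw [hk.neg_one_pow, Nat.succ_eq_add_one]
  ring

theorem tsum_transCoeff_le_one (k : ℕ) : ∑' i, transCoeff k i ≤ 1 := by
  rcases k.even_or_odd with hk | hk
  · exact (tsum_transCoeff_of_even hk).le
  rw [(hasSum_transCoeff k).tsum_eq]
  refine le_trans ?_ (hasSum_inv_pow_sub_inv_pow k.succ_ne_zero).tsum_eq.le
  have hle : ∀ j : ℕ, ((2 * (j + 1) - 1 : ℝ)⁻¹) ^ (k + 1) - ((2 * (j + 1) : ℝ)⁻¹) ^ (k + 1)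
      + (-1) ^ k * (((2 * (j + 1) : ℝ)⁻¹) ^ (k + 1) - ((2 * (j + 1) + 1 : ℝ)⁻¹) ^ (k + 1))
      ≤ ((2 * (j + 1) - 1 : ℝ)⁻¹) ^ (k + 1) - ((2 * (j + 1) + 1 : ℝ)⁻¹) ^ (k + 1) := by
    intro j
    obtain ⟨h1, h2, h3⟩ := inv_pow_bounds j (k + 1)
    rw [hk.neg_one_pow]
    linarith
  have hs := (hasSum_inv_pow_sub_inv_pow k.succ_ne_zero).summable
  exact Summable.tsum_le_tsum hle (Summable.of_nonneg_of_le
    (fun j => (hasSum_branchCoeff k j).nonneg (branchCoeff_nonneg k j)) hle hs) hs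

theorem transCoeff_nonneg (k i : ℕ) : 0 ≤ transCoeff k i :=
  tsum_nonneg fun j => branchCoeff_nonneg k j i

theorem transCoeff_pos {k i : ℕ} (h : Even (k + i)) : 0 < transCoeff k i := by
  have hs : Summable fun j => branchCoeff k j i :=
    (summable_branchCoeff_prod k).prod_symm.prod_factor i
  refine hs.tsum_pos (fun j => branchCoeff_nonneg k j i) 0 ?_
  have : 0 < (k + i + 1).choose (i + 1) := Nat.choose_pos (by omega)
  rw [branchCoeff, h.neg_one_pow]
  positivity

theorem transCoeff_eq_zero {k i : ℕ} (h : ¬ Even (k + i)) : transCoeff k i = 0 := by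
  simp [transCoeff, branchCoeff, (Nat.not_even_iff_odd.1 h).neg_one_pow]

/-- A Lyapunov function for the matrix `transCoeff`. -/
noncomputable def lyapunov (i : ℕ) : ℝ := (i + 1) - if i = 0 then 1 else 0

theorem lyapunov_nonneg (i : ℕ) : 0 ≤ lyapunov i := by
  unfold lyapunov
  split_ifs <;> simp
  positivity

theorem hasSum_transCoeff_mul_lyapunov (k : ℕ) :
    ∃ S ≤ (k + 1 : ℝ), HasSum (fun i => transCoeff k i * lyapunov i) S := by
  set A : ℕ → ℝ := fun j => (k + 1) * (((2 * (j + 1) - 1 : ℝ)⁻¹) ^ (k + 2) +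
    (-1) ^ k * ((2 * (j + 1) + 1 : ℝ)⁻¹) ^ (k + 2)) - branchCoeff k j 0 with hA
  have h : ∀ j, HasSum (fun i => branchCoeff k j i * lyapunov i) (A j) := by
    intro j
    have h1 := hasSum_branchCoeff_mul_pow k j (x := 1) (by simp)
    have h2 : HasSum (fun i : ℕ => branchCoeff k j i * if i = 0 then 1 else 0)
        (branchCoeff k j 0) := by
      simpa using hasSum_single (f := fun i : ℕ => branchCoeff k j i * if i = 0 then 1 else 0) 0
        (fun i hi => by simp [hi])
    refine (h1.sub h2).congr_fun fun i => ?_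
    rw [lyapunov]
    ring
  have hnn : ∀ j i, 0 ≤ branchCoeff k j i * lyapunov i := fun j i =>
    mul_nonneg (branchCoeff_nonneg k j i) (lyapunov_nonneg i)
  have hle : ∀ j, A j ≤ (k + 1) *
      (((2 * (j + 1) - 1 : ℝ)⁻¹) ^ (k + 2) - ((2 * (j + 1) + 1 : ℝ)⁻¹) ^ (k + 2)) := by
    intro j
    obtain ⟨h1, h2, h3⟩ := inv_pow_bounds j (k + 2)
    have hb : branchCoeff k j 0 = (1 + (-1) ^ k) * (k + 1) * ((2 * (j + 1) : ℝ)⁻¹) ^ (k + 2) := by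
      simp [branchCoeff]
    simp only [hA, hb]
    have hk : (0 : ℝ) ≤ k + 1 := by positivity
    rcases neg_one_pow_eq_or ℝ k with h | h <;> rw [h]
    · nlinarith
    · nlinarith
  have hs := (hasSum_inv_pow_sub_inv_pow (p := k + 2) (by omega)).mul_left ((k : ℝ) + 1)
  have hAs : Summable A := Summable.of_nonneg_of_le (fun j => (h j).nonneg (hnn j)) hle hs.summable
  refine ⟨∑' j, A j, ?_, ?_⟩
  · rw [← mul_one ((k : ℝ) + 1), ← hs.tsum_eq]
    exact Summable.tsum_le_tsum hle hAs hs.summable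
  · refine (hasSum_tsum_swap (summable_prod_of_hasSum hnn h hAs) h).congr_fun fun i => ?_
    rw [tsum_mul_right, transCoeff]

theorem tendsto_lyapunov : Tendsto lyapunov atTop atTop := by
  refine tendsto_atTop_mono (fun i => ?_) (tendsto_natCast_atTop_atTop (R := ℝ))
  unfold lyapunov
  split_ifs <;> simp

theorem summable_inv_odd_pow (k : ℕ) :
    Summable fun j : ℕ => ((2 * (j + 1) - 1 : ℝ)⁻¹) ^ (k + 2) := by
  have h := (summable_nat_add_iff 1).2 (Real.summable_nat_pow_inv (p := k + 2).2 (by omega))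
  refine Summable.of_nonneg_of_le (fun j => ?_) (fun j => ?_) h
  · have hj : (0 : ℝ) < 2 * (j + 1) - 1 := by have := j.cast_nonneg (α := ℝ); linarith
    positivity
  · have hj := j.cast_nonneg (α := ℝ)
    rw [← inv_pow]
    refine pow_le_pow_left₀ (inv_nonneg.2 (by linarith)) (inv_anti₀ (by positivity) ?_) _
    push_cast
    linarith

theorem hasSum_transCoeff_mul_pow (k : ℕ) {x : ℝ} (hx : |x| ≤ 1) :
    Summable (fun j : ℕ => ((2 * (j + 1) - x : ℝ)⁻¹) ^ (k + 2)) ∧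
    HasSum (fun i : ℕ => transCoeff k i * (i + 1) * x ^ i)
      ((k + 1) * ∑' j : ℕ, (((2 * (j + 1) - x : ℝ)⁻¹) ^ (k + 2) +
        (-1) ^ k * ((2 * (j + 1) + x : ℝ)⁻¹) ^ (k + 2))) := by
  have hx' := abs_le.1 hx
  constructor
  · refine Summable.of_nonneg_of_le (fun j => ?_) (fun j => ?_) (summable_inv_odd_pow k)
    · have hj : (0 : ℝ) < 2 * (j + 1) - x := by have := j.cast_nonneg (α := ℝ); linarith
      positivity
    · have hj : (0 : ℝ) < 2 * (j + 1) - 1 := by have := j.cast_nonneg (α := ℝ); linarith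
      exact pow_le_pow_left₀ (inv_nonneg.2 (by linarith)) (inv_anti₀ hj (by linarith)) _
  have hnn : ∀ j i : ℕ, 0 ≤ branchCoeff k j i * (i + 1) * 1 ^ i := fun j i => by
    have := branchCoeff_nonneg k j i
    positivity
  have h1 := fun j => hasSum_branchCoeff_mul_pow k j (x := 1) (by simp)
  have hs : Summable fun p : ℕ × ℕ => branchCoeff k p.1 p.2 * (p.2 + 1) * 1 ^ p.2 := by
    refine summable_prod_of_hasSum hnn h1 (Summable.of_nonneg_of_le
      (fun j => (h1 j).nonneg (hnn j)) (fun j => ?_)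
      ((summable_inv_odd_pow k).mul_left (2 * ((k : ℝ) + 1))))
    obtain ⟨h1, h2, h3⟩ := inv_pow_bounds j (k + 2)
    have hk : (0 : ℝ) ≤ k + 1 := by positivity
    rcases neg_one_pow_eq_or ℝ k with h | h <;> rw [h] <;> nlinarith
  have hs' : Summable fun p : ℕ × ℕ => branchCoeff k p.1 p.2 * (p.2 + 1) * x ^ p.2 := by
    refine Summable.of_norm_bounded hs fun p => ?_
    have := branchCoeff_nonneg k p.1 p.2
    rw [norm_mul, norm_pow, Real.norm_of_nonneg (by positivity), one_pow, Real.norm_eq_abs]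
    exact mul_le_mul_of_nonneg_left (pow_le_one₀ (abs_nonneg x) hx) (by positivity)
  rw [← tsum_mul_left]
  refine (hasSum_tsum_swap hs' fun j => hasSum_branchCoeff_mul_pow k j hx).congr_fun fun i => ?_
  rw [tsum_mul_right, tsum_mul_right, transCoeff]

end Coefficients

section Operator

theorem one_lt_abs_add_two_mul {x : ℝ} (hx : x ∈ Ioo (-1 : ℝ) 1) {j : ℤ} (hj : j ≠ 0) :
    1 < |x + 2 * (j : ℝ)| := by
  rcases hx with ⟨h1, h2⟩
  rcases lt_or_gt_of_ne hj with h | h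
  · have : (j : ℝ) ≤ -1 := by exact_mod_cast Int.le_sub_one_of_lt h
    exact lt_abs.2 (Or.inr (by linarith))
  · have : (1 : ℝ) ≤ j := by exact_mod_cast h
    exact lt_abs.2 (Or.inl (by linarith))

theorem neg_one_div_mem_Ioo {x : ℝ} (hx : x ∈ Ioo (-1 : ℝ) 1) {j : ℤ} (hj : j ≠ 0) :
    -1 / (x + 2 * (j : ℝ)) ∈ Ioo (-1 : ℝ) 1 := by
  rw [mem_Ioo, ← abs_lt, abs_div, abs_neg, abs_one]
  have := one_lt_abs_add_two_mul hx hj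
  rw [div_lt_one (by linarith)]
  exact this

theorem add_two_mul_ne_zero {x : ℝ} (hx : x ∈ Ioo (-1 : ℝ) 1) {j : ℤ} (hj : j ≠ 0) :
    x + 2 * (j : ℝ) ≠ 0 := by
  have := one_lt_abs_add_two_mul hx hj
  exact abs_pos.1 (by linarith)

theorem eq_of_neg_one_div_eq {x y : ℝ} (hx : x ∈ Ioo (-1 : ℝ) 1) (hy : y ∈ Ioo (-1 : ℝ) 1)
    {i j : ℤ} (h : -1 / (x + 2 * (i : ℝ)) = -1 / (y + 2 * (j : ℝ))) : i = j ∧ x = y := by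
  have h1 : x + 2 * (i : ℝ) = y + 2 * (j : ℝ) := by
    simpa [neg_div] using h
  have hij : i = j := by
    have h2 : (i : ℝ) - j < 1 := by linarith [hx.1, hy.2]
    have h3 : (j : ℝ) - i < 1 := by linarith [hx.2, hy.1]
    have h4 : i - j < 1 := by exact_mod_cast h2
    have h5 : j - i < 1 := by exact_mod_cast h3
    omega
  subst hij
  exact ⟨rfl, by linarith⟩

/-- The change of variables formula along the branches `x ↦ -1 / (x + 2 j)`. -/
theorem lintegral_tsum_branch_le {G : ℝ → ENNReal} (hG : Measurable G) :
    ∫⁻ x in Ioo (-1 : ℝ) 1, ∑' j : {j : ℤ // j ≠ 0},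
      ENNReal.ofReal (1 / (x + 2 * ((j : ℤ) : ℝ)) ^ 2) * G (-1 / (x + 2 * ((j : ℤ) : ℝ)))
      ≤ ∫⁻ x in Ioo (-1 : ℝ) 1, G x := by
  rw [lintegral_tsum fun j => by fun_prop]
  have hcv : ∀ j : {j : ℤ // j ≠ 0}, ∫⁻ x in Ioo (-1 : ℝ) 1,
      ENNReal.ofReal (1 / (x + 2 * ((j : ℤ) : ℝ)) ^ 2) * G (-1 / (x + 2 * ((j : ℤ) : ℝ)))
      = ∫⁻ y in (fun x : ℝ => -1 / (x + 2 * ((j : ℤ) : ℝ))) '' Ioo (-1 : ℝ) 1, G y := by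
    intro j
    rw [lintegral_image_eq_lintegral_abs_deriv_mul measurableSet_Ioo
      (f' := fun x => 1 / (x + 2 * ((j : ℤ) : ℝ)) ^ 2)]
    · refine lintegral_congr fun x => ?_
      rw [abs_of_nonneg (by positivity)]
    · intro x hx
      have hne := add_two_mul_ne_zero hx j.2
      have h := (((hasDerivAt_id x).add_const (2 * ((j : ℤ) : ℝ))).inv hne).neg
      refine (h.congr_deriv (by simp [id, neg_div])).hasDerivWithinAt.congr_of_mem ?_ hx
      intro y _
      simp [neg_div]
    · intro x hx y hy hxy
      exact (eq_of_neg_one_div_eq hx hy hxy).2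
  simp_rw [hcv]
  rw [← lintegral_iUnion]
  · refine lintegral_mono_set ?_
    rintro y hy
    obtain ⟨j, x, hx, rfl⟩ := mem_iUnion.1 hy
    exact neg_one_div_mem_Ioo hx j.2
  · intro j
    refine measurableSet_Ioo.image_of_measurable_injOn (by fun_prop) ?_
    intro x hx y hy hxy
    exact (eq_of_neg_one_div_eq hx hy hxy).2
  · intro i j hij
    refine disjoint_left.2 ?_
    rintro _ ⟨x, hx, rfl⟩ ⟨y, hy, hxy⟩
    exact hij (Subtype.ext (eq_of_neg_one_div_eq hy hx hxy).1.symm)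

theorem Tsub_congr_ae {f g : ℝ → ℝ} (h : f =ᵐ[volume.restrict (Ioo (-1 : ℝ) 1)] g) :
    Tsub 1 f =ᵐ[volume.restrict (Ioo (-1 : ℝ) 1)] Tsub 1 g := by
  set μ := volume.restrict (Ioo (-1 : ℝ) 1) with hμ
  set M := toMeasurable μ {x | ¬ f x = g x} with hM
  have hM0 : μ M = 0 := by rw [hM, measure_toMeasurable]; exact h
  have hMm : MeasurableSet M := measurableSet_toMeasurable _ _
  have hG : Measurable (M.indicator (1 : ℝ → ENNReal)) := measurable_one.indicator hMm
  have h1 := lintegral_tsum_branch_le hG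
  rw [← hμ, lintegral_indicator_one hMm, hM0, nonpos_iff_eq_zero, lintegral_eq_zero_iff
    (Measurable.tsum fun j => by fun_prop)] at h1
  filter_upwards [h1, ae_restrict_mem measurableSet_Ioo] with x hx hxI
  refine tsum_congr fun j => ?_
  have h2 := (ENNReal.tsum_eq_zero.1 hx) j
  have hne := add_two_mul_ne_zero hxI j.2
  have hpos : (0 : ℝ) < 1 / (x + 2 * ((j : ℤ) : ℝ)) ^ 2 := by positivity
  have h3 : -1 / (x + 2 * ((j : ℤ) : ℝ)) ∉ M := by
    intro hmem
    simp only [indicator_of_mem hmem, Pi.one_apply, mul_one, ENNReal.ofReal_eq_zero] at h2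
    linarith
  have h4 : f (-1 / (x + 2 * ((j : ℤ) : ℝ))) = g (-1 / (x + 2 * ((j : ℤ) : ℝ))) := by
    by_contra hcon
    exact h3 (subset_toMeasurable μ _ hcon)
  rw [h4]

theorem Tsub_iterate_congr_ae {f g : ℝ → ℝ} (h : f =ᵐ[volume.restrict (Ioo (-1 : ℝ) 1)] g)
    (n : ℕ) : (Tsub 1)^[n] f =ᵐ[volume.restrict (Ioo (-1 : ℝ) 1)] (Tsub 1)^[n] g := by
  induction n with
  | zero => exact h
  | succ n ih =>
    rw [Function.iterate_succ_apply', Function.iterate_succ_apply']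
    exact Tsub_congr_ae ih

theorem lintegral_tsum_enorm_le {f : ℝ → ℝ} (hf : Measurable f) :
    ∫⁻ x in Ioo (-1 : ℝ) 1, ∑' j : {j : ℤ // j ≠ 0},
      ‖1 / (x + 2 * ((j : ℤ) : ℝ)) ^ 2 * f (-1 / (x + 2 * ((j : ℤ) : ℝ)))‖ₑ
      ≤ ∫⁻ x in Ioo (-1 : ℝ) 1, ‖f x‖ₑ := by
  refine le_trans (le_of_eq ?_) (lintegral_tsum_branch_le hf.enorm)
  refine lintegral_congr fun x => tsum_congr fun j => ?_
  rw [enorm_mul, Real.enorm_of_nonneg (by positivity)]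

theorem measurable_Tsub {f : ℝ → ℝ} (hf : Measurable f) : Measurable (Tsub 1 f) := by
  unfold Tsub
  exact Measurable.tsum fun j => by fun_prop

theorem lintegral_enorm_Tsub_le {f : ℝ → ℝ} (hf : Measurable f) :
    ∫⁻ x in Ioo (-1 : ℝ) 1, ‖Tsub 1 f x‖ₑ ≤ ∫⁻ x in Ioo (-1 : ℝ) 1, ‖f x‖ₑ :=
  (lintegral_mono fun _ => enorm_tsum_le_tsum_enorm).trans (lintegral_tsum_enorm_le hf)

theorem ae_summable_Tsub {f : ℝ → ℝ} (hf : Measurable f)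
    (hfi : Integrable f (volume.restrict (Ioo (-1 : ℝ) 1))) :
    ∀ᵐ x ∂volume.restrict (Ioo (-1 : ℝ) 1), Summable fun j : {j : ℤ // j ≠ 0} =>
      1 / (x + 2 * ((j : ℤ) : ℝ)) ^ 2 * f (-1 / (x + 2 * ((j : ℤ) : ℝ))) := by
  have h := (lintegral_tsum_enorm_le hf).trans_lt hfi.hasFiniteIntegral
  filter_upwards [ae_lt_top (Measurable.tsum fun j => by fun_prop) h.ne] with x hx
  exact (tsum_enorm_ne_top_iff_summable_norm.1 hx.ne).of_norm

theorem integrable_Tsub {f : ℝ → ℝ} (hf : Measurable f)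
    (hfi : Integrable f (volume.restrict (Ioo (-1 : ℝ) 1))) :
    Integrable (Tsub 1 f) (volume.restrict (Ioo (-1 : ℝ) 1)) :=
  ⟨(measurable_Tsub hf).aestronglyMeasurable,
    (lintegral_enorm_Tsub_le hf).trans_lt hfi.hasFiniteIntegral⟩

theorem hasSum_int_ne_zero {f : ℤ → ℝ} {m m' : ℝ} (h : HasSum (fun n : ℕ => f (n + 1)) m)
    (h' : HasSum (fun n : ℕ => f (-(n + 1))) m') :
    HasSum (fun j : {j : ℤ // j ≠ 0} => f j) (m + m') := by
  refine (hasSum_subtype_iff_indicator (f := f) (s := {j : ℤ | j ≠ 0})).2 ?_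
  have hpos : ∀ n : ℕ, (n + 1 : ℤ) ∈ {j : ℤ | j ≠ 0} := fun n => by
    simp only [mem_ofPred_eq]; omega
  have hneg : ∀ n : ℕ, (-(n + 1) : ℤ) ∈ {j : ℤ | j ≠ 0} := fun n => by
    simp only [mem_ofPred_eq]; omega
  have h1 := HasSum.of_add_one_of_neg_add_one (f := {j : ℤ | j ≠ 0}.indicator f) (m := m) (m' := m')
    (h.congr_fun fun n => by rw [indicator_of_mem (hpos n)])
    (h'.congr_fun fun n => by rw [indicator_of_mem (hneg n)])
  simpa using h1

/-- The `L¹` contraction induced by `T₁`. -/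
noncomputable def subtransferL1 : (ℝ →₁[volume.restrict (Ioo (-1 : ℝ) 1)] ℝ) →L[ℝ]
    (ℝ →₁[volume.restrict (Ioo (-1 : ℝ) 1)] ℝ) :=
  LinearMap.mkContinuous
    { toFun := fun F => Integrable.toL1 (Tsub 1 F)
        (integrable_Tsub (Lp.stronglyMeasurable F).measurable (L1.integrable_coeFn F))
      map_add' := by
        intro F G
        rw [← Integrable.toL1_add]
        refine (Integrable.toL1_eq_toL1_iff _ _ _ _).2 ((Tsub_congr_ae (Lp.coeFn_add F G)).trans ?_)
        filter_upwards [ae_summable_Tsub (Lp.stronglyMeasurable F).measurable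
          (L1.integrable_coeFn F), ae_summable_Tsub (Lp.stronglyMeasurable G).measurable
          (L1.integrable_coeFn G)] with x hF hG
        simp only [Tsub, Pi.add_apply, mul_add]
        exact hF.tsum_add hG
      map_smul' := by
        intro c F
        rw [RingHom.id_apply, ← Integrable.toL1_smul]
        refine (Integrable.toL1_eq_toL1_iff _ _ _ _).2
          ((Tsub_congr_ae (Lp.coeFn_smul c F)).trans (Eventually.of_forall fun x => ?_))
        simp only [Tsub, Pi.smul_apply, smul_eq_mul, mul_left_comm _ c]
        exact tsum_mul_left }
    1 (by
      intro F
      rw [one_mul, LinearMap.coe_mk, AddHom.coe_mk, Integrable.norm_toL1, L1.norm_def]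
      simp_rw [edist_zero_right]
      exact ENNReal.toReal_mono (L1.integrable_coeFn F).hasFiniteIntegral.ne
        (lintegral_enorm_Tsub_le (Lp.stronglyMeasurable F).measurable))

theorem norm_subtransferL1_le (F : ℝ →₁[volume.restrict (Ioo (-1 : ℝ) 1)] ℝ) :
    ‖subtransferL1 F‖ ≤ ‖F‖ := by
  have h := subtransferL1.le_of_opNorm_le (LinearMap.mkContinuous_norm_le _ zero_le_one _) F
  rwa [one_mul] at h

theorem coeFn_subtransferL1 (F : ℝ →₁[volume.restrict (Ioo (-1 : ℝ) 1)] ℝ) :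
    subtransferL1 F =ᵐ[volume.restrict (Ioo (-1 : ℝ) 1)] Tsub 1 F :=
  Integrable.coeFn_toL1
    (integrable_Tsub (Lp.stronglyMeasurable F).measurable (L1.integrable_coeFn F))

theorem coeFn_subtransferL1_pow (F : ℝ →₁[volume.restrict (Ioo (-1 : ℝ) 1)] ℝ) (n : ℕ) :
    (subtransferL1 ^ n) F =ᵐ[volume.restrict (Ioo (-1 : ℝ) 1)] (Tsub 1)^[n] F := by
  induction n with
  | zero => exact EventuallyEq.rfl
  | succ n ih =>
    rw [pow_succ', Function.iterate_succ_apply']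
    exact (coeFn_subtransferL1 _).trans (Tsub_congr_ae ih)

theorem coeFn_subtransferL1_pow_toL1 {f : ℝ → ℝ}
    (hf : Integrable f (volume.restrict (Ioo (-1 : ℝ) 1))) (n : ℕ) :
    (subtransferL1 ^ n) (hf.toL1 f) =ᵐ[volume.restrict (Ioo (-1 : ℝ) 1)] (Tsub 1)^[n] f :=
  (coeFn_subtransferL1_pow _ n).trans (Tsub_iterate_congr_ae hf.coeFn_toL1 n)

theorem norm_subtransferL1_pow_toL1 {f : ℝ → ℝ}
    (hf : Integrable f (volume.restrict (Ioo (-1 : ℝ) 1))) (n : ℕ) :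
    ‖(subtransferL1 ^ n) (hf.toL1 f)‖ = ∫ x in Ioo (-1 : ℝ) 1, |(Tsub 1)^[n] f x| := by
  rw [L1.norm_eq_integral_norm]
  refine integral_congr_ae ?_
  filter_upwards [coeFn_subtransferL1_pow_toL1 hf n] with x hx
  rw [hx, Real.norm_eq_abs]

theorem Continuous.integrable_restrict_Ioo {f : ℝ → ℝ} (hf : Continuous f) (a b : ℝ) :
    Integrable f (volume.restrict (Ioo a b)) :=
  hf.integrableOn_Icc.mono_set Ioo_subset_Icc_self

/-- The monomials, normalised in `L¹`. -/
noncomputable def monomialL1 (k : ℕ) : ℝ →₁[volume.restrict (Ioo (-1 : ℝ) 1)] ℝ :=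
  Integrable.toL1 (fun x : ℝ => (k + 1) / 2 * x ^ k)
    (Continuous.integrable_restrict_Ioo (by fun_prop) _ _)

theorem coeFn_monomialL1 (k : ℕ) :
    monomialL1 k =ᵐ[volume.restrict (Ioo (-1 : ℝ) 1)] fun x : ℝ => (k + 1) / 2 * x ^ k :=
  Integrable.coeFn_toL1 _

theorem norm_monomialL1_le (k : ℕ) : ‖monomialL1 k‖ ≤ 1 := by
  rw [monomialL1, L1.norm_of_fun_eq_integral_norm, ← integral_Ioc_eq_integral_Ioo,
    ← intervalIntegral.integral_of_le (by norm_num),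
    ← intervalIntegral.integral_add_adjacent_intervals (b := 0)
      (Continuous.intervalIntegrable (by fun_prop) _ _)
      (Continuous.intervalIntegrable (by fun_prop) _ _)]
  have h1 : ∫ x in (0 : ℝ)..1, ‖((k : ℝ) + 1) / 2 * x ^ k‖ = 1 / 2 := by
    have h : ∫ x in (0 : ℝ)..1, ‖((k : ℝ) + 1) / 2 * x ^ k‖ =
        ∫ x in (0 : ℝ)..1, ((k : ℝ) + 1) / 2 * x ^ k := by
      refine intervalIntegral.integral_congr fun x hx => ?_
      rw [uIcc_of_le zero_le_one] at hx
      have := hx.1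
      exact Real.norm_of_nonneg (by positivity)
    rw [h, intervalIntegral.integral_const_mul, integral_pow]
    have : (k : ℝ) + 1 ≠ 0 := by positivity
    field_simp
    simp
  have h2 : ∫ x in (-1 : ℝ)..0, ‖((k : ℝ) + 1) / 2 * x ^ k‖ = 1 / 2 := by
    rw [← h1]
    have h := intervalIntegral.integral_comp_neg (a := (0 : ℝ)) (b := 1)
      (fun x : ℝ => ‖((k : ℝ) + 1) / 2 * x ^ k‖)
    rw [neg_zero] at h
    rw [← h]
    simp
  rw [h1, h2]
  norm_num

theorem integral_monomialL1 (k : ℕ) :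
    ∫ x in Ioo (-1 : ℝ) 1, monomialL1 k x = if Even k then 1 else 0 := by
  rw [integral_congr_ae (coeFn_monomialL1 k), ← integral_Ioc_eq_integral_Ioo,
    ← intervalIntegral.integral_of_le (by norm_num), intervalIntegral.integral_const_mul,
    integral_pow]
  have hk : (k : ℝ) + 1 ≠ 0 := by positivity
  split_ifs with h
  · rw [h.add_one.neg_one_pow]
    field_simp
    norm_num
  · rw [(Nat.not_even_iff_odd.1 h).add_one.neg_one_pow]
    simp

theorem Tsub_pow (k : ℕ) {x : ℝ} (hx : |x| ≤ 1) : Tsub 1 (fun y => y ^ k) x =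
    ∑' j : ℕ, (((2 * (j + 1) - x : ℝ)⁻¹) ^ (k + 2) +
      (-1) ^ k * ((2 * (j + 1) + x : ℝ)⁻¹) ^ (k + 2)) := by
  have h1 := (hasSum_transCoeff_mul_pow k hx).1
  have h2 := (hasSum_transCoeff_mul_pow k (x := -x) (by rwa [abs_neg])).1.mul_left ((-1 : ℝ) ^ k)
  simp only [sub_neg_eq_add] at h2
  rw [h1.tsum_add h2, add_comm]
  refine (hasSum_int_ne_zero (f := fun j : ℤ => 1 / (x + 2 * (j : ℝ)) ^ 2 *
    (-1 / (x + 2 * (j : ℝ))) ^ k) (h2.hasSum.congr_fun fun n => ?_)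
    (h1.hasSum.congr_fun fun n => ?_)).tsum_eq
  · push_cast
    rw [show x + 2 * ((n : ℝ) + 1) = 2 * (n + 1) + x by ring, div_eq_mul_inv (-1 : ℝ), mul_pow,
      one_div, ← inv_pow]
    ring
  · push_cast
    rw [show x + 2 * -((n : ℝ) + 1) = -(2 * (n + 1) - x) by ring, neg_div_neg_eq, neg_sq, one_div,
      one_div, ← inv_pow]
    ring

theorem hasSum_subtransferL1_monomialL1 (k : ℕ) :
    HasSum (fun i => transCoeff k i • monomialL1 i) (subtransferL1 (monomialL1 k)) := by
  have hn : Summable fun i => ‖transCoeff k i • monomialL1 i‖ := by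
    refine Summable.of_nonneg_of_le (fun i => norm_nonneg _) (fun i => ?_)
      (hasSum_transCoeff k).summable
    rw [norm_smul, Real.norm_of_nonneg (transCoeff_nonneg k i)]
    exact mul_le_of_le_one_right (transCoeff_nonneg k i) (norm_monomialL1_le i)
  convert hn.of_norm.hasSum using 1
  refine Lp.ext ?_
  have h1 := Lp.hasSum_coeFn_tsum (tsum_enorm_ne_top_iff_summable_norm.2 hn)
  have h2 : ∀ᵐ x ∂volume.restrict (Ioo (-1 : ℝ) 1), ∀ i,
      (transCoeff k i • monomialL1 i : ℝ →₁[volume.restrict (Ioo (-1 : ℝ) 1)] ℝ) x =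
        transCoeff k i * ((i + 1) / 2 * x ^ i) := by
    rw [ae_all_iff]
    intro i
    filter_upwards [Lp.coeFn_smul (transCoeff k i) (monomialL1 i), coeFn_monomialL1 i] with x hx hx'
    rw [hx, Pi.smul_apply, hx', smul_eq_mul]
  filter_upwards [h1, h2, (coeFn_subtransferL1 _).trans (Tsub_congr_ae (coeFn_monomialL1 k)),
    ae_restrict_mem measurableSet_Ioo] with x h3 h4 h5 hx
  have hx1 : |x| ≤ 1 := (abs_lt.2 hx).le
  have h6 := (hasSum_transCoeff_mul_pow k hx1).2.mul_left (1 / 2)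
  have h7 : Tsub 1 (fun y : ℝ => ((k : ℝ) + 1) / 2 * y ^ k) x =
      (k + 1) / 2 * Tsub 1 (fun y => y ^ k) x := by
    simp only [Tsub, mul_left_comm _ (((k : ℝ) + 1) / 2)]
    exact tsum_mul_left
  rw [h5, h7, Tsub_pow k hx1]
  simp_rw [h4] at h3
  rw [h3.unique (h6.congr_fun fun i => by ring)]
  ring

end Operator

section Convergence

theorem asympNorm_subtransferL1_monomialL1 (k : ℕ) : asympNorm subtransferL1
    (monomialL1 k - (if Even k then (1 : ℝ) else 0) • monomialL1 0) = 0 := by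
  have hV : ∀ k, k ≠ 0 → lyapunov k = k + 1 := fun k hk => by simp [lyapunov, hk]
  refine asympNorm_sub_eq_zero (P := transCoeff) (V := lyapunov) norm_subtransferL1_le
    norm_monomialL1_le transCoeff_nonneg (fun _ _ => transCoeff_pos)
    (fun _ _ => transCoeff_eq_zero) (fun k => (hasSum_transCoeff k).summable)
    tsum_transCoeff_le_one (fun _ => tsum_transCoeff_of_even) (by simp [lyapunov]) tendsto_lyapunov
    (fun k _ => ?_) (fun k hk => ?_) hasSum_subtransferL1_monomialL1 k
  · obtain ⟨S, -, hS⟩ := hasSum_transCoeff_mul_lyapunov k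
    exact hS.summable
  · obtain ⟨S, hle, hS⟩ := hasSum_transCoeff_mul_lyapunov k
    rw [hS.tsum_eq, hV k hk]
    exact hle

/-- The operator subtracting from a function its mean. -/
noncomputable def centerL1 : (ℝ →₁[volume.restrict (Ioo (-1 : ℝ) 1)] ℝ) →L[ℝ]
    (ℝ →₁[volume.restrict (Ioo (-1 : ℝ) 1)] ℝ) :=
  ContinuousLinearMap.id ℝ _ - (L1.integralCLM).smulRight (monomialL1 0)

theorem centerL1_apply (F : ℝ →₁[volume.restrict (Ioo (-1 : ℝ) 1)] ℝ) :
    centerL1 F = F - (∫ x in Ioo (-1 : ℝ) 1, F x) • monomialL1 0 := by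
  rw [← L1.integral_eq_integral, L1.integral_eq]
  rfl

theorem asympNorm_centerL1_polynomial (p : Polynomial ℝ) : asympNorm subtransferL1
    (centerL1 ((p.continuous.integrable_restrict_Ioo (-1) 1).toL1 fun x => p.eval x)) = 0 := by
  induction p using Polynomial.induction_on' with
  | add p q hp hq =>
    refine le_antisymm ?_ (asympNorm_nonneg _)
    have h : ((p + q).continuous.integrable_restrict_Ioo (-1) 1).toL1 (fun x => (p + q).eval x) =
        (p.continuous.integrable_restrict_Ioo (-1) 1).toL1 (fun x => p.eval x) +
        (q.continuous.integrable_restrict_Ioo (-1) 1).toL1 (fun x => q.eval x) := by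
      rw [← Integrable.toL1_add]
      exact (Integrable.toL1_eq_toL1_iff _ _ _ _).2
        (Eventually.of_forall fun x => Polynomial.eval_add)
    rw [h, map_add]
    refine (asympNorm_add_le norm_subtransferL1_le _ _).trans ?_
    rw [hp, hq, add_zero]
  | monomial k c =>
    have h : ((Polynomial.monomial k c).continuous.integrable_restrict_Ioo (-1) 1).toL1
        (fun x => (Polynomial.monomial k c).eval x) = (2 * c / (k + 1)) • monomialL1 k := by
      rw [monomialL1, ← Integrable.toL1_smul]
      refine (Integrable.toL1_eq_toL1_iff _ _ _ _).2 (Eventually.of_forall fun x => ?_)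
      have hk : (k : ℝ) + 1 ≠ 0 := by positivity
      simp only [Polynomial.eval_monomial, smul_eq_mul]
      field_simp
    rw [h, map_smul, asympNorm_smul norm_subtransferL1_le, centerL1_apply, integral_monomialL1,
      asympNorm_subtransferL1_monomialL1, mul_zero]

theorem exists_polynomial_norm_toL1_sub_le {f : ℝ → ℝ}
    (hf : Integrable f (volume.restrict (Ioo (-1 : ℝ) 1))) {ε : ℝ} (hε : 0 < ε) :
    ∃ p : Polynomial ℝ,
      ‖hf.toL1 f - (p.continuous.integrable_restrict_Ioo (-1) 1).toL1 fun x => p.eval x‖ ≤ ε := by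
  obtain ⟨g, -, hfg, hgc, hg⟩ :=
    hf.exists_hasCompactSupport_integral_sub_le (show 0 < ε / 3 by positivity)
  obtain ⟨p, hp⟩ := exists_polynomial_near_of_continuousOn (-1) 1 g hgc.continuousOn (ε / 3)
    (by positivity)
  refine ⟨p, ?_⟩
  have hpi := p.continuous.integrable_restrict_Ioo (-1) 1
  rw [← Integrable.toL1_sub, L1.norm_of_fun_eq_integral_norm]
  calc ∫ x in Ioo (-1 : ℝ) 1, ‖(f - fun x => p.eval x) x‖
      ≤ ∫ x in Ioo (-1 : ℝ) 1, (‖f x - g x‖ + ε / 3) := by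
        refine integral_mono_ae (hf.sub hpi).norm ((hf.sub hg).norm.add (integrable_const _)) ?_
        filter_upwards [ae_restrict_mem measurableSet_Ioo] with x hx
        have h1 := hp x (Ioo_subset_Icc_self hx)
        rw [abs_sub_comm] at h1
        have h2 := norm_add_le (f x - g x) (g x - p.eval x)
        rw [sub_add_sub_cancel] at h2
        rw [Pi.sub_apply]
        rw [Real.norm_eq_abs (g x - _)] at h2
        linarith
    _ = (∫ x in Ioo (-1 : ℝ) 1, ‖f x - g x‖) + 2 * (ε / 3) := by
        have hfgi : Integrable (fun x => ‖f x - g x‖) (volume.restrict (Ioo (-1 : ℝ) 1)) :=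
          (hf.sub hg).norm
        rw [integral_add hfgi (integrable_const _)]
        simp
        norm_num
    _ ≤ ε := by linarith

theorem asympNorm_centerL1_toL1 {f : ℝ → ℝ}
    (hf : Integrable f (volume.restrict (Ioo (-1 : ℝ) 1))) :
    asympNorm subtransferL1 (centerL1 (hf.toL1 f)) = 0 := by
  refine le_antisymm (le_of_forall_pos_le_add fun ε hε => ?_) (asympNorm_nonneg _)
  set C := ‖centerL1‖ + 1 with hC
  have hC0 : 0 < C := by positivity
  obtain ⟨p, hp⟩ := exists_polynomial_norm_toL1_sub_le hf (show 0 < ε / C by positivity)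
  set Q := (p.continuous.integrable_restrict_Ioo (-1) 1).toL1 fun x => p.eval x with hQ
  have h1 := asympNorm_add_le norm_subtransferL1_le (centerL1 (hf.toL1 f - Q)) (centerL1 Q)
  rw [← map_add, sub_add_cancel, asympNorm_centerL1_polynomial, add_zero] at h1
  have h2 : ‖centerL1 (hf.toL1 f - Q)‖ ≤ C * (ε / C) :=
    (centerL1.le_opNorm _).trans (mul_le_mul (by linarith) hp (norm_nonneg _) hC0.le)
  rw [mul_div_cancel₀ _ hC0.ne'] at h2
  rw [zero_add]
  exact h1.trans ((asympNorm_le_norm _).trans h2)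

theorem tendsto_integral_abs_Tsub_iterate {f : ℝ → ℝ}
    (hf : Integrable f (volume.restrict (Ioo (-1 : ℝ) 1)))
    (h0 : ∫ x in Ioo (-1 : ℝ) 1, f x = 0) :
    Tendsto (fun N : ℕ => ∫ x in Ioo (-1 : ℝ) 1, |(Tsub 1)^[N] f x|) atTop (𝓝 0) := by
  have h := tendsto_asympNorm norm_subtransferL1_le (centerL1 (hf.toL1 f))
  rw [asympNorm_centerL1_toL1, centerL1_apply, integral_congr_ae hf.coeFn_toL1, h0, zero_smul,
    sub_zero] at h
  exact h.congr fun n => norm_subtransferL1_pow_toL1 hf n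

theorem hasSum_one_div_sq_sub_one {y : ℝ} (hy : |y| < 1) :
    HasSum (fun n : ℕ => 1 / ((y + 2 * (n + 1)) ^ 2 - 1)) (1 / (2 * (1 + y))) := by
  have hy' := abs_lt.1 hy
  have hpos : ∀ n : ℕ, 0 < y + 2 * n + 1 := fun n => by
    have := n.cast_nonneg (α := ℝ); linarith
  have hterm : ∀ n : ℕ, 1 / ((y + 2 * (n + 1)) ^ 2 - 1) =
      1 / 2 * (y + 2 * n + 1)⁻¹ - 1 / 2 * (y + 2 * (n + 1 : ℕ) + 1)⁻¹ := by
    intro n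
    have h1 := hpos n
    have h2 := hpos (n + 1)
    have h3 : (y + 2 * ((n : ℝ) + 1)) ^ 2 - 1 = (y + 2 * n + 1) * (y + 2 * (n + 1 : ℕ) + 1) := by
      push_cast; ring
    rw [h3]
    field_simp
    push_cast
    ring
  rw [hasSum_iff_tendsto_nat_of_nonneg fun n => ?_]
  · simp_rw [hterm, Finset.sum_range_sub' fun n : ℕ => 1 / 2 * (y + 2 * n + 1)⁻¹]
    have h2 : Tendsto (fun n : ℕ => (y + 2 * n + 1 : ℝ)⁻¹) atTop (𝓝 0) := by
      refine tendsto_inv_atTop_zero.comp ?_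
      exact tendsto_atTop_add_const_right _ _ (tendsto_atTop_add_const_left _ _
        (tendsto_natCast_atTop_atTop.const_mul_atTop two_pos))
    have h3 := (h2.const_mul (1 / 2)).const_sub (1 / 2 * (y + 2 * (0 : ℕ) + 1)⁻¹)
    convert h3 using 2
    have := hpos 0
    simp only [CharP.cast_eq_zero, mul_zero, add_zero] at this
    simp only [CharP.cast_eq_zero, mul_zero, add_zero, sub_zero]
    rw [add_comm y 1, one_div, mul_inv]
    ring
  · have := n.cast_nonneg (α := ℝ)
    have h1 : 1 < y + 2 * ((n : ℝ) + 1) := by linarith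
    have h2 : 0 < (y + 2 * ((n : ℝ) + 1)) ^ 2 - 1 := by nlinarith
    positivity

/-- The function `x ↦ 1 / (1 - x ^ 2)` is invariant under `T₁`. -/
theorem hasSum_branch_one_div_one_sub_sq {x : ℝ} (hx : x ∈ Ioo (-1 : ℝ) 1) :
    HasSum (fun j : {j : ℤ // j ≠ 0} => 1 / (x + 2 * ((j : ℤ) : ℝ)) ^ 2 *
      (1 / (1 - (-1 / (x + 2 * ((j : ℤ) : ℝ))) ^ 2))) (1 / (1 - x ^ 2)) := by
  have hx1 : |x| < 1 := abs_lt.2 hx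
  have h1 := hasSum_one_div_sq_sub_one hx1
  have h2 := hasSum_one_div_sq_sub_one (y := -x) (by rwa [abs_neg])
  have h3 := hasSum_int_ne_zero (f := fun j : ℤ => 1 / ((x + 2 * (j : ℝ)) ^ 2 - 1))
    (h1.congr_fun fun n => by push_cast; rfl)
    (h2.congr_fun fun n => by push_cast; congr 2; ring)
  convert h3 using 1
  · ext j
    have hne := add_two_mul_ne_zero hx j.2
    have hlt := one_lt_abs_add_two_mul hx j.2
    have hsq : 1 < (x + 2 * ((j : ℤ) : ℝ)) ^ 2 := by
      rw [← sq_abs]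
      nlinarith
    have hsq1 : (x + 2 * ((j : ℤ) : ℝ)) ^ 2 - 1 ≠ 0 := by linarith
    rw [div_pow, neg_sq, one_pow, one_div_mul_one_div]
    congr 1
    rw [mul_sub, mul_one, mul_one_div_cancel (by positivity)]
  · have h4 : 1 + x ≠ 0 := by linarith [hx.1]
    have h5 : 1 + -x ≠ 0 := by linarith [hx.2]
    have h6 : 1 - x ^ 2 = (1 + x) * (1 + -x) := by ring
    rw [h6]
    field_simp
    ring

theorem abs_Tsub_iterate_le {g : ℝ → ℝ} (hg : ∀ x ∈ Ioo (-1 : ℝ) 1, |g x| ≤ 1 / (1 - x ^ 2))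
    (n : ℕ) : ∀ x ∈ Ioo (-1 : ℝ) 1, |(Tsub 1)^[n] g x| ≤ 1 / (1 - x ^ 2) := by
  induction n with
  | zero => exact hg
  | succ n ih =>
    intro x hx
    rw [Function.iterate_succ_apply', ← Real.norm_eq_abs]
    refine tsum_of_norm_bounded (hasSum_branch_one_div_one_sub_sq hx) fun j => ?_
    rw [norm_mul, Real.norm_of_nonneg (by positivity)]
    exact mul_le_mul_of_nonneg_left (ih _ (neg_one_div_mem_Ioo hx j.2)) (by positivity)

theorem sum_pow_le_one_div_one_sub_sq (n : ℕ) {x : ℝ} (hx : x ∈ Ioo (-1 : ℝ) 1) :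
    |∑ k ∈ Finset.range n, x ^ (2 * k)| ≤ 1 / (1 - x ^ 2) := by
  have h1 : 0 < 1 - x ^ 2 := by nlinarith [hx.1, hx.2]
  simp_rw [pow_mul]
  rw [abs_of_nonneg (Finset.sum_nonneg fun k _ => by positivity), le_div_iff₀ h1,
    geom_sum_mul_neg]
  have : 0 ≤ (x ^ 2) ^ n := by positivity
  linarith

theorem integral_sum_pow (n : ℕ) :
    ∫ x in Ioo (-1 : ℝ) 1, ∑ k ∈ Finset.range n, x ^ (2 * k) =
      ∑ k ∈ Finset.range n, 2 / (2 * k + 1 : ℝ) := by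
  rw [← integral_Ioc_eq_integral_Ioo, ← intervalIntegral.integral_of_le (by norm_num),
    intervalIntegral.integral_finsetSum
      fun k _ => Continuous.intervalIntegrable (by fun_prop) _ _]
  refine Finset.sum_congr rfl fun k _ => ?_
  rw [integral_pow, (even_two_mul k).add_one.neg_one_pow]
  push_cast
  norm_num

theorem tendsto_sum_two_div : Tendsto
    (fun n : ℕ => ∑ k ∈ Finset.range n, 2 / (2 * k + 1 : ℝ)) atTop atTop := by
  refine tendsto_atTop_mono (fun n => Finset.sum_le_sum fun k _ => ?_)
    Real.tendsto_sum_range_one_div_nat_succ_atTop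
  rw [div_le_div_iff₀ (by positivity) (by positivity)]
  linarith

theorem setIntegral_abs_Tsub_iterate_le {f p : ℝ → ℝ} {c η : ℝ}
    (hf : Integrable f (volume.restrict (Ioo (-1 : ℝ) 1)))
    (hpi : Integrable p (volume.restrict (Ioo (-1 : ℝ) 1)))
    (hp : ∀ x ∈ Ioo (-1 : ℝ) 1, |p x| ≤ 1 / (1 - x ^ 2)) (hη : 0 < η) (hη1 : η < 1) (N : ℕ) :
    ∫ x in Ioo (-η) η, |(Tsub 1)^[N] f x| ≤
      (∫ x in Ioo (-1 : ℝ) 1, |(Tsub 1)^[N] (f - c • p) x|) + |c| * (2 * η / (1 - η ^ 2)) := by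
  have hu : Integrable (f - c • p) (volume.restrict (Ioo (-1 : ℝ) 1)) := hf.sub (hpi.smul c)
  have hsub : Ioo (-η) η ⊆ Ioo (-1 : ℝ) 1 := Ioo_subset_Ioo (by linarith) hη1.le
  have hint : ∀ {g : ℝ → ℝ} (_ : Integrable g (volume.restrict (Ioo (-1 : ℝ) 1))),
      Integrable (fun x => |(Tsub 1)^[N] g x|) (volume.restrict (Ioo (-1 : ℝ) 1)) := fun hg =>
    ((L1.integrable_coeFn _).congr (coeFn_subtransferL1_pow_toL1 hg N)).abs
  have hsplit : hf.toL1 f = hu.toL1 (f - c • p) + c • hpi.toL1 p := by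
    rw [← Integrable.toL1_smul' p hpi c, ← Integrable.toL1_add]
    exact (Integrable.toL1_eq_toL1_iff _ _ _ _).2 (by rw [sub_add_cancel])
  have hae : ∀ᵐ x ∂volume.restrict (Ioo (-1 : ℝ) 1),
      (Tsub 1)^[N] f x = (Tsub 1)^[N] (f - c • p) x + c * (Tsub 1)^[N] p x := by
    have h1 := coeFn_subtransferL1_pow_toL1 hf N
    rw [hsplit, map_add, map_smul] at h1
    filter_upwards [h1, Lp.coeFn_add ((subtransferL1 ^ N) (hu.toL1 (f - c • p)))
      (c • (subtransferL1 ^ N) (hpi.toL1 p)), Lp.coeFn_smul c ((subtransferL1 ^ N) (hpi.toL1 p)),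
      coeFn_subtransferL1_pow_toL1 hu N, coeFn_subtransferL1_pow_toL1 hpi N] with x e1 e2 e3 e4 e5
    rw [← e1, e2, Pi.add_apply, e3, e4, Pi.smul_apply, e5, smul_eq_mul]
  have hη2 : 0 < 1 - η ^ 2 := by nlinarith
  calc ∫ x in Ioo (-η) η, |(Tsub 1)^[N] f x|
      ≤ ∫ x in Ioo (-η) η, (|(Tsub 1)^[N] (f - c • p) x| + |c| * (1 / (1 - η ^ 2))) := by
        refine integral_mono_ae (IntegrableOn.mono_set (hint hf) hsub)
          ((IntegrableOn.mono_set (hint hu) hsub).add (integrable_const _)) ?_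
        filter_upwards [ae_restrict_of_ae_restrict_of_subset hsub hae,
          ae_restrict_mem measurableSet_Ioo] with x hx hxη
        have h1 := abs_Tsub_iterate_le hp N x (hsub hxη)
        have h2 : 1 / (1 - x ^ 2) ≤ 1 / (1 - η ^ 2) :=
          one_div_le_one_div_of_le hη2 (by nlinarith [hxη.1, hxη.2])
        rw [hx]
        refine (abs_add_le _ _).trans (add_le_add le_rfl ?_)
        rw [abs_mul]
        exact mul_le_mul_of_nonneg_left (h1.trans h2) (abs_nonneg c)
    _ = (∫ x in Ioo (-η) η, |(Tsub 1)^[N] (f - c • p) x|) + |c| * (2 * η / (1 - η ^ 2)) := by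
        rw [integral_add (IntegrableOn.mono_set (hint hu) hsub) (integrable_const _),
          setIntegral_const, Real.volume_real_Ioo_of_le (by linarith), smul_eq_mul]
        ring
    _ ≤ _ := by
        exact add_le_add (setIntegral_mono_set (hint hu)
          (Eventually.of_forall fun x => abs_nonneg _) hsub.eventuallyLE) le_rfl

theorem tendsto_setIntegral_abs_Tsub_iterate {f : ℝ → ℝ}
    (hf : Integrable f (volume.restrict (Ioo (-1 : ℝ) 1))) {η : ℝ} (hη : 0 < η) (hη1 : η < 1) :
    Tendsto (fun N : ℕ => ∫ x in Ioo (-η) η, |(Tsub 1)^[N] f x|) atTop (𝓝 0) := by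
  set m := ∫ x in Ioo (-1 : ℝ) 1, f x with hm
  set S : ℕ → ℝ := fun n => ∑ k ∈ Finset.range n, 2 / (2 * k + 1 : ℝ) with hS
  have hlim : Tendsto (fun n => |m / S n| * (2 * η / (1 - η ^ 2))) atTop (𝓝 0) := by
    have h := ((tendsto_const_nhds (x := m)).div_atTop tendsto_sum_two_div).abs.mul_const
      (2 * η / (1 - η ^ 2))
    rwa [abs_zero, zero_mul] at h
  rw [Metric.tendsto_atTop]
  intro ε hε
  obtain ⟨n, hn, hSn⟩ := ((hlim.eventually_lt_const (half_pos hε)).and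
    (tendsto_sum_two_div.eventually_gt_atTop 0)).exists
  set p : ℝ → ℝ := fun x => ∑ k ∈ Finset.range n, x ^ (2 * k) with hp
  have hpi : Integrable p (volume.restrict (Ioo (-1 : ℝ) 1)) :=
    Continuous.integrable_restrict_Ioo (by fun_prop) _ _
  have hu : Integrable (f - (m / S n) • p) (volume.restrict (Ioo (-1 : ℝ) 1)) :=
    hf.sub (hpi.smul _)
  have hu0 : ∫ x in Ioo (-1 : ℝ) 1, (f - (m / S n) • p) x = 0 := by
    have hSn' : S n ≠ 0 := ne_of_gt hSn
    rw [integral_sub' hf (hpi.smul _)]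
    simp only [Pi.smul_apply, smul_eq_mul]
    rw [integral_const_mul, integral_sum_pow, ← hm, div_mul_cancel₀ _ hSn', sub_self]
  obtain ⟨N₀, hN₀⟩ := eventually_atTop.1
    ((tendsto_integral_abs_Tsub_iterate hu hu0).eventually_lt_const (half_pos hε))
  refine ⟨N₀, fun N hN => ?_⟩
  rw [dist_zero_right, Real.norm_of_nonneg (integral_nonneg fun x => abs_nonneg _)]
  have h := setIntegral_abs_Tsub_iterate_le (c := m / S n) hf hpi
    (fun x hx => sum_pow_le_one_div_one_sub_sq n hx) hη hη1 N
  linarith [hN₀ N hN]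

end Convergence

/-- For `β = 1`: (a) if `f ∈ L¹(I₁)` has mean zero then `‖T₁^N f‖_{L¹(I₁)} → 0`;
(b) for arbitrary `f ∈ L¹(I₁)` and every `0 < η < 1`, `∫_{-η}^{η} |T₁^N f| → 0`. -/
theorem subtransfer_one_iterates_decay
    (f : ℝ → ℝ) (hf : IntegrableOn f (Ioo (-1) 1)) :
    ((∫ t in Ioo (-1 : ℝ) 1, f t) = 0 →
      Tendsto (fun N : ℕ => ∫ x in Ioo (-1 : ℝ) 1, |(Tsub 1)^[N] f x|) atTop (nhds 0)) ∧
    (∀ η : ℝ, 0 < η → η < 1 →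
      Tendsto (fun N : ℕ => ∫ x in Ioo (-η) η, |(Tsub 1)^[N] f x|) atTop (nhds 0)) :=
  ⟨tendsto_integral_abs_Tsub_iterate hf,
    fun _ hη hη1 => tendsto_setIntegral_abs_Tsub_iterate hf hη hη1⟩
end

section
/- For each fixed t ∈ (−1,1), the function x ↦ k₁^{II}(1,x) − k₁^{II}(t,x) is odd and strictly increasing on the interval (−1,1). -/
open Set

/-- The odd part of the dynamically reduced Hilbert kernel:
`k₁^{II}(t,x) = t²x/(1-t²x²) + ∑_{j≥1} [2x/(4j²-x²) - x/((2j-t)²-x²) - x/((2j+t)²-x²)]`. -/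
noncomputable def kII (t x : ℝ) : ℝ :=
  t ^ 2 * x / (1 - t ^ 2 * x ^ 2) +
    ∑' j : ℕ, (2 * x / (4 * ((j : ℝ) + 1) ^ 2 - x ^ 2)
      - x / ((2 * ((j : ℝ) + 1) - t) ^ 2 - x ^ 2)
      - x / ((2 * ((j : ℝ) + 1) + t) ^ 2 - x ^ 2))

/-- The partial fraction term `x / (a² - x²)` is summable along `a = 2j + b`. -/
lemma summable_div_sq_sub_sq {b x : ℝ} (hb : 1 ≤ b) (hx : x ∈ Ioo (-1 : ℝ) 1) :
    Summable fun j : ℕ => x / ((2 * (j : ℝ) + b) ^ 2 - x ^ 2) := by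
  obtain ⟨h₁, h₂⟩ := hx
  have hx2 : 0 < 1 - x ^ 2 := by nlinarith
  have hs : Summable fun j : ℕ => (1 - x ^ 2)⁻¹ * (1 / ((j + 1 : ℕ) : ℝ) ^ 2) :=
    ((summable_nat_add_iff 1).2 (Real.summable_one_div_nat_pow.2 one_lt_two)).mul_left _
  refine hs.of_norm_bounded fun j => ?_
  have hj : (0 : ℝ) ≤ j := j.cast_nonneg
  have hle : (1 - x ^ 2) * ((j : ℝ) + 1) ^ 2 ≤ (2 * (j : ℝ) + b) ^ 2 - x ^ 2 := by
    nlinarith [mul_nonneg (sq_nonneg x) hj, mul_nonneg (sq_nonneg x) (sq_nonneg (j : ℝ)),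
      mul_nonneg hj hj, mul_nonneg hj (sub_nonneg.2 hb), mul_nonneg (sub_nonneg.2 hb)
      (sub_nonneg.2 hb)]
  have hpos : 0 < (1 - x ^ 2) * ((j : ℝ) + 1) ^ 2 := by positivity
  rw [Real.norm_eq_abs, abs_div, abs_of_pos (hpos.trans_le hle), ← one_div, div_mul_div_comm,
    one_mul]
  push_cast
  exact div_le_div₀ zero_le_one (abs_le.2 ⟨h₁.le, h₂.le⟩) hpos hle

lemma kII_neg_right (t x : ℝ) : kII t (-x) = -kII t x := by
  unfold kII
  rw [neg_add, ← tsum_neg]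
  congr 1
  · ring
  · congr 1
    ext j
    ring

lemma kII_neg_left (t x : ℝ) : kII (-t) x = kII t x := by
  unfold kII
  rw [neg_sq]
  congr 2
  ext j
  rw [sub_neg_eq_add, ← sub_eq_add_neg]
  ring

/-- The difference of kernels as a monotone term plus a series of second differences. -/
lemma kII_one_sub_kII {t x : ℝ} (ht₀ : 0 ≤ t) (ht₁ : t < 1) (hx : x ∈ Ioo (-1 : ℝ) 1) :
    HasSum (fun j : ℕ => x / ((2 * (j : ℝ) + (4 - t)) ^ 2 - x ^ 2)
        + x / ((2 * (j : ℝ) + (2 + t)) ^ 2 - x ^ 2) - 2 * (x / ((2 * (j : ℝ) + 3) ^ 2 - x ^ 2)))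
      (kII 1 x - kII t x - (x / ((2 - t) ^ 2 - x ^ 2) - t ^ 2 * x / (1 - t ^ 2 * x ^ 2))) := by
  set H : ℝ → ℝ := fun b => ∑' j : ℕ, x / ((2 * (j : ℝ) + b) ^ 2 - x ^ 2)
  have hH : ∀ b, 1 ≤ b → HasSum (fun j : ℕ => x / ((2 * (j : ℝ) + b) ^ 2 - x ^ 2)) (H b) :=
    fun b hb => (summable_div_sq_sub_sq hb hx).hasSum
  have hshift : ∀ b, 1 ≤ b → H b = x / (b ^ 2 - x ^ 2) + H (b + 2) := by
    intro b hb
    refine (summable_div_sq_sub_sq hb hx).tsum_eq_zero_add.trans ?_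
    congr 1
    · simp
    · refine tsum_congr fun j => ?_
      push_cast
      ring_nf
  have hk : ∀ s, 0 ≤ s → s ≤ 1 →
      kII s x = s ^ 2 * x / (1 - s ^ 2 * x ^ 2) + (2 * H 2 - H (2 - s) - H (2 + s)) := by
    intro s hs₀ hs₁
    have h := (((hH 2 (by norm_num)).mul_left 2).sub (hH (2 - s) (by linarith))).sub
      (hH (2 + s) (by linarith))
    rw [kII, ← h.tsum_eq]
    congr 1
    refine tsum_congr fun j => ?_
    ring_nf
  have e₁ := hshift 1 le_rfl
  have e₂ := hshift (2 - t) (by linarith)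
  rw [show (1 : ℝ) + 2 = 3 by norm_num] at e₁
  rw [show 2 - t + 2 = 4 - t by ring] at e₂
  have hval : kII 1 x - kII t x
      - (x / ((2 - t) ^ 2 - x ^ 2) - t ^ 2 * x / (1 - t ^ 2 * x ^ 2)) =
        H (4 - t) + H (2 + t) - 2 * H 3 := by
    rw [hk 1 zero_le_one le_rfl, hk t ht₀ ht₁.le, show (2 : ℝ) - 1 = 1 by norm_num,
      show (2 : ℝ) + 1 = 3 by norm_num, e₁, e₂]
    simp only [one_pow, one_mul]
    ring
  rw [hval]
  exact ((hH (4 - t) (by linarith)).add (hH (2 + t) (by linarith))).sub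
    ((hH 3 (by norm_num)).mul_left 2)

/-- The second difference of `a ↦ x / (a² - x²)` is nondecreasing in `x`. -/
lemma second_difference_mono {a s x y : ℝ} (ha : 3 ≤ a) (hs₀ : 0 ≤ s) (hs₁ : s ≤ 1)
    (hx : x ∈ Ioo (-1 : ℝ) 1) (hy : y ∈ Ioo (-1 : ℝ) 1) (hxy : x ≤ y) :
    x / ((a + s) ^ 2 - x ^ 2) + x / ((a - s) ^ 2 - x ^ 2) - 2 * (x / (a ^ 2 - x ^ 2)) ≤
      y / ((a + s) ^ 2 - y ^ 2) + y / ((a - s) ^ 2 - y ^ 2) - 2 * (y / (a ^ 2 - y ^ 2)) := by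
  have key : ∀ z ∈ Ioo (-1 : ℝ) 1,
      z / ((a + s) ^ 2 - z ^ 2) + z / ((a - s) ^ 2 - z ^ 2) - 2 * (z / (a ^ 2 - z ^ 2)) =
        s ^ 2 * (1 / ((a - z) * ((a - z) ^ 2 - s ^ 2)) -
          1 / ((a + z) * ((a + z) ^ 2 - s ^ 2))) := by
    rintro z ⟨h₁, h₂⟩
    rw [show (a + s) ^ 2 - z ^ 2 = (a + s - z) * (a + s + z) by ring,
      show (a - s) ^ 2 - z ^ 2 = (a - s - z) * (a - s + z) by ring,
      show a ^ 2 - z ^ 2 = (a - z) * (a + z) by ring,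
      show (a - z) ^ 2 - s ^ 2 = (a + s - z) * (a - s - z) by ring,
      show (a + z) ^ 2 - s ^ 2 = (a + s + z) * (a - s + z) by ring]
    have n₁ : a + s - z ≠ 0 := by linarith
    have n₂ : a + s + z ≠ 0 := by linarith
    have n₃ : a - s - z ≠ 0 := by linarith
    have n₄ : a - s + z ≠ 0 := by linarith
    have n₅ : a - z ≠ 0 := by linarith
    have n₆ : a + z ≠ 0 := by linarith
    field_simp
    ring
  have anti : ∀ u v : ℝ, 2 ≤ u → u ≤ v →
      1 / (v * (v ^ 2 - s ^ 2)) ≤ 1 / (u * (u ^ 2 - s ^ 2)) := by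
    intro u v hu huv
    have hpos : 0 < u ^ 2 - s ^ 2 := by nlinarith
    have hle : u ^ 2 - s ^ 2 ≤ v ^ 2 - s ^ 2 := by nlinarith
    have hu₀ : 0 < u := by linarith
    exact one_div_le_one_div_of_le (by positivity)
      (mul_le_mul huv hle hpos.le (by linarith))
  rw [key x hx, key y hy]
  obtain ⟨hx₁, hx₂⟩ := hx
  obtain ⟨hy₁, hy₂⟩ := hy
  exact mul_le_mul_of_nonneg_left (sub_le_sub (anti _ _ (by linarith) (by linarith))
    (anti _ _ (by linarith) (by linarith))) (sq_nonneg s)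

lemma leading_term_strictMono {t x y : ℝ} (ht₀ : 0 ≤ t) (ht₁ : t < 1)
    (hx : x ∈ Ioo (-1 : ℝ) 1) (hy : y ∈ Ioo (-1 : ℝ) 1) (hxy : x < y) :
    x / ((2 - t) ^ 2 - x ^ 2) - t ^ 2 * x / (1 - t ^ 2 * x ^ 2) <
      y / ((2 - t) ^ 2 - y ^ 2) - t ^ 2 * y / (1 - t ^ 2 * y ^ 2) := by
  have key : ∀ z ∈ Ioo (-1 : ℝ) 1,
      z / ((2 - t) ^ 2 - z ^ 2) - t ^ 2 * z / (1 - t ^ 2 * z ^ 2) =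
        (1 - t) ^ 2 / 2 * (1 / ((2 - t - z) * (1 - t * z)) -
          1 / ((2 - t + z) * (1 + t * z))) := by
    rintro z ⟨h₁, h₂⟩
    rw [show (2 - t) ^ 2 - z ^ 2 = (2 - t - z) * (2 - t + z) by ring,
      show 1 - t ^ 2 * z ^ 2 = (1 - t * z) * (1 + t * z) by ring]
    have n₁ : 2 - t - z ≠ 0 := by linarith
    have n₂ : 2 - t + z ≠ 0 := by linarith
    have n₃ : 1 - t * z ≠ 0 := by nlinarith
    have n₄ : 1 + t * z ≠ 0 := by nlinarith
    generalize hp : 1 - t * z = p at *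
    generalize hq : 1 + t * z = q at *
    field_simp
    subst hp hq
    ring
  have anti : ∀ u v : ℝ, u ∈ Ioo (-1 : ℝ) 1 → v ∈ Ioo (-1 : ℝ) 1 → u < v →
      1 / ((2 - t - u) * (1 - t * u)) < 1 / ((2 - t - v) * (1 - t * v)) := by
    rintro u v ⟨hu₁, hu₂⟩ ⟨hv₁, hv₂⟩ huv
    have p₁ : 0 < 2 - t - v := by linarith
    have p₂ : 0 < 1 - t * v := by nlinarith
    exact one_div_lt_one_div_of_lt (by positivity)
      (mul_lt_mul (by linarith) (by nlinarith) p₂ (by linarith))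
  rw [key x hx, key y hy]
  have h₁ := anti x y hx hy hxy
  have h₂ := anti (-y) (-x) ⟨by linarith [hy.2], by linarith [hy.1]⟩
    ⟨by linarith [hx.2], by linarith [hx.1]⟩ (by linarith)
  simp only [sub_neg_eq_add, mul_neg] at h₂
  have hpos : 0 < 1 - t := by linarith
  exact mul_lt_mul_of_pos_left (by linarith) (by positivity)

lemma strictMonoOn_kII_one_sub_kII {t : ℝ} (ht₀ : 0 ≤ t) (ht₁ : t < 1) :
    StrictMonoOn (fun x => kII 1 x - kII t x) (Ioo (-1 : ℝ) 1) := by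
  intro x hx y hy hxy
  have hle := hasSum_le (fun j : ℕ => ?_) (kII_one_sub_kII ht₀ ht₁ hx) (kII_one_sub_kII ht₀ ht₁ hy)
  · have hlt := leading_term_strictMono ht₀ ht₁ hx hy hxy
    dsimp only
    linarith
  · have hj : (0 : ℝ) ≤ j := j.cast_nonneg
    have h := second_difference_mono (a := 2 * j + 3) (s := 1 - t) (by linarith) (by linarith)
      (by linarith) hx hy hxy.le
    rwa [show 2 * (j : ℝ) + 3 + (1 - t) = 2 * j + (4 - t) by ring,
      show 2 * (j : ℝ) + 3 - (1 - t) = 2 * j + (2 + t) by ring] at h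

/-- For each fixed `t ∈ (-1,1)`, the function `x ↦ k₁^{II}(1,x) - k₁^{II}(t,x)` is odd and
strictly increasing on `(-1,1)`. -/
theorem kII_difference_odd_strictMono (t : ℝ) (ht : t ∈ Ioo (-1 : ℝ) 1) :
    (∀ x ∈ Ioo (-1 : ℝ) 1, kII 1 (-x) - kII t (-x) = -(kII 1 x - kII t x)) ∧
    StrictMonoOn (fun x => kII 1 x - kII t x) (Ioo (-1 : ℝ) 1) := by
  refine ⟨fun x _ => by rw [kII_neg_right, kII_neg_right]; ring, ?_⟩
  rcases le_total 0 t with h | h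
  · exact strictMonoOn_kII_one_sub_kII h ht.2
  · simpa only [kII_neg_left] using
      strictMonoOn_kII_one_sub_kII (neg_nonneg.2 h) (neg_lt.1 ht.1)
end

section
/- For each fixed t ∈ (0,1), let κ_j(t) := t^{2j+2} + ∑_{k=1}^{∞} [2/(2k)^{2j+2} − 1/(2k−t)^{2j+2} − 1/(2k+t)^{2j+2}] for j = 0,1,2,…. Then: (i) κ₀(t) = π²/12 + 1/t² − (π²/4)/sin²(πt/2) + t², and κ₀(t) > 0; (ii) the sequence j ↦ (2−t)^{2j+2}·κ_j(t) is strictly decreasing for j ≥ 1 and converges to −1 as j → +∞; and consequently (iii) there exists j₀ ∈ ℕ such that κ_j(t) ≥ 0 for all j ≤ j₀ and κ_j(t) ≤ 0 for all j > j₀. -/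
open Set Filter

/-- The Taylor coefficients `κ_j(t)` of the odd part of the dynamically reduced Hilbert
kernel:
`κ_j(t) = t^{2j+2} + ∑_{k≥1} [2/(2k)^{2j+2} - 1/(2k-t)^{2j+2} - 1/(2k+t)^{2j+2}]`. -/
noncomputable def kapCoef (j : ℕ) (t : ℝ) : ℝ :=
  t ^ (2 * j + 2) +
    ∑' k : ℕ, (2 / (2 * ((k : ℝ) + 1)) ^ (2 * j + 2)
      - 1 / (2 * ((k : ℝ) + 1) - t) ^ (2 * j + 2)
      - 1 / (2 * ((k : ℝ) + 1) + t) ^ (2 * j + 2))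

/-- The second difference with step `h` of the function `c ↦ c⁻ⁿ`. -/
noncomputable def recipPowDiff (n : ℕ) (h c : ℝ) : ℝ :=
  (1 / (c - h)) ^ n + (1 / (c + h)) ^ n - 2 * (1 / c) ^ n

theorem one_div_pow_sub_succ {x : ℝ} (hx : x < 1) (hx' : -1 < x) (n : ℕ) :
    (1 / (1 - x)) ^ (n + 1) - (1 / (1 + x)) ^ (n + 1) =
      1 / (1 - x) * ((1 / (1 - x)) ^ n - (1 / (1 + x)) ^ n) +
        2 * x / (1 - x ^ 2) * (1 / (1 + x)) ^ n := by
  have h1 : 1 - x ≠ 0 := by linarith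
  have h2 : 1 + x ≠ 0 := by linarith
  have h3 : 2 * x / (1 - x ^ 2) = 1 / (1 - x) - 1 / (1 + x) := by
    rw [show 1 - x ^ 2 = (1 - x) * (1 + x) by ring]
    field_simp
    ring
  rw [h3]
  ring

theorem one_div_pow_add_succ {x : ℝ} (hx : x < 1) (hx' : -1 < x) (n : ℕ) :
    (1 / (1 - x)) ^ (n + 1) + (1 / (1 + x)) ^ (n + 1) - 2 =
      ((1 / (1 - x)) ^ n + (1 / (1 + x)) ^ n - 2) +
        x * ((1 / (1 - x)) ^ (n + 1) - (1 / (1 + x)) ^ (n + 1)) := by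
  have h1 : 1 - x ≠ 0 := by linarith
  have h2 : 1 + x ≠ 0 := by linarith
  have h3 : x * (1 / (1 - x)) = 1 / (1 - x) - 1 := by
    field_simp
    ring
  have h4 : x * (1 / (1 + x)) = 1 - 1 / (1 + x) := by
    field_simp
    ring
  rw [pow_succ, pow_succ]
  linear_combination (1 / (1 + x)) ^ n * h4 - (1 / (1 - x)) ^ n * h3

theorem one_div_pow_sub_nonneg {x : ℝ} (h0 : 0 ≤ x) (h1 : x < 1) (n : ℕ) :
    0 ≤ (1 / (1 - x)) ^ n - (1 / (1 + x)) ^ n := by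
  have : 1 / (1 + x) ≤ 1 / (1 - x) := one_div_le_one_div_of_le (by linarith) (by linarith)
  have := pow_le_pow_left₀ (by positivity) this n
  linarith

theorem one_div_pow_add_nonneg {x : ℝ} (h0 : 0 ≤ x) (h1 : x < 1) (n : ℕ) :
    0 ≤ (1 / (1 - x)) ^ n + (1 / (1 + x)) ^ n - 2 := by
  induction n with
  | zero => norm_num
  | succ n ih =>
    rw [one_div_pow_add_succ h1 (by linarith)]
    have := one_div_pow_sub_nonneg h0 h1 (n + 1)
    positivity

theorem one_div_pow_sub_le {x : ℝ} (h0 : 0 ≤ x) (h1 : x ≤ 1 / 4) {n : ℕ} (hn : 4 ≤ n) :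
    (1 / (1 - x)) ^ n - (1 / (1 + x)) ^ n ≤ 3 * x * (3 / 2) ^ n := by
  have hx2 : x ^ 2 ≤ 1 / 16 := by nlinarith
  induction n, hn using Nat.le_induction with
  | base =>
    have hp : 1 - x ≠ 0 := by linarith
    have hq : 1 + x ≠ 0 := by linarith
    have e : (1 / (1 - x)) ^ 4 - (1 / (1 + x)) ^ 4 = 8 * x * (1 + x ^ 2) / (1 - x ^ 2) ^ 4 := by
      rw [show 1 - x ^ 2 = (1 - x) * (1 + x) by ring]
      field_simp
      ring
    have hb : (15 / 16 : ℝ) ^ 4 ≤ (1 - x ^ 2) ^ 4 :=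
      pow_le_pow_left₀ (by norm_num) (by linarith) 4
    rw [e, div_le_iff₀ (by linarith [show (0 : ℝ) < (15 / 16) ^ 4 by norm_num])]
    have : 8 * (1 + x ^ 2) ≤ 3 * (3 / 2) ^ 4 * (1 - x ^ 2) ^ 4 := by
      norm_num at hb ⊢
      linarith
    nlinarith
  | succ n hn ih =>
    rw [one_div_pow_sub_succ (by linarith) (by linarith)]
    have hu : 1 / (1 - x) ≤ 4 / 3 := by
      rw [div_le_div_iff₀ (by linarith) (by norm_num)]
      linarith
    have hd : 2 * x / (1 - x ^ 2) ≤ 32 / 15 * x := by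
      rw [div_le_iff₀ (by linarith)]
      nlinarith
    have hv : (1 / (1 + x)) ^ n ≤ 1 :=
      pow_le_one₀ (by positivity) (by rw [div_le_one (by positivity)]; linarith)
    have hA : (81 / 16 : ℝ) ≤ (3 / 2) ^ n := by
      have : (3 / 2 : ℝ) ^ 4 ≤ (3 / 2) ^ n := pow_le_pow_right₀ (by norm_num) hn
      norm_num at this ⊢
      linarith
    have e1 := mul_le_mul hu ih (one_div_pow_sub_nonneg h0 (by linarith) n) (by norm_num)
    have e2 := mul_le_mul hd hv (by positivity) (by positivity)
    have e3 := mul_le_mul_of_nonneg_left hA h0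
    rw [pow_succ (3 / 2 : ℝ)]
    nlinarith

theorem one_div_pow_add_le {x : ℝ} (h0 : 0 ≤ x) (h1 : x ≤ 1 / 4) {n : ℕ} (hn : 4 ≤ n) :
    (1 / (1 - x)) ^ n + (1 / (1 + x)) ^ n - 2 ≤ 9 * x ^ 2 * (3 / 2) ^ n := by
  have hx2 : x ^ 2 ≤ 1 / 16 := by nlinarith
  induction n, hn using Nat.le_induction with
  | base =>
    have hp : 1 - x ≠ 0 := by linarith
    have hq : 1 + x ≠ 0 := by linarith
    have e : (1 / (1 - x)) ^ 4 + (1 / (1 + x)) ^ 4 - 2 =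
        x ^ 2 * (20 - 10 * x ^ 2 + 8 * x ^ 4 - 2 * x ^ 6) / (1 - x ^ 2) ^ 4 := by
      rw [show 1 - x ^ 2 = (1 - x) * (1 + x) by ring]
      field_simp
      ring
    have hb : (15 / 16 : ℝ) ^ 4 ≤ (1 - x ^ 2) ^ 4 :=
      pow_le_pow_left₀ (by norm_num) (by linarith) 4
    rw [e, div_le_iff₀ (by linarith [show (0 : ℝ) < (15 / 16) ^ 4 by norm_num])]
    have h6 : 0 ≤ x ^ 6 := by positivity
    have h4 : x ^ 4 ≤ x ^ 2 := by nlinarith [sq_nonneg x]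
    have : 20 - 10 * x ^ 2 + 8 * x ^ 4 - 2 * x ^ 6 ≤ 9 * (3 / 2) ^ 4 * (1 - x ^ 2) ^ 4 := by
      norm_num at hb ⊢
      linarith [sq_nonneg x]
    nlinarith [sq_nonneg x]
  | succ n hn ih =>
    rw [one_div_pow_add_succ (by linarith) (by linarith)]
    have e := mul_le_mul_of_nonneg_left
      (one_div_pow_sub_le h0 h1 (show 4 ≤ n + 1 by lia)) h0
    rw [pow_succ (3 / 2 : ℝ)] at *
    nlinarith

theorem recipPowDiff_eq {h c : ℝ} (h0 : 0 ≤ h) (hc : h < c) (n : ℕ) :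
    recipPowDiff n h c =
      (1 / c) ^ n * ((1 / (1 - h / c)) ^ n + (1 / (1 + h / c)) ^ n - 2) := by
  have hc0 : c ≠ 0 := by linarith
  have h1 : 1 / (c - h) = 1 / c * (1 / (1 - h / c)) := by
    rw [one_div_mul_one_div, mul_sub, mul_one, mul_div_cancel₀ _ hc0]
  have h2 : 1 / (c + h) = 1 / c * (1 / (1 + h / c)) := by
    rw [one_div_mul_one_div, mul_add, mul_one, mul_div_cancel₀ _ hc0]
  rw [recipPowDiff, h1, h2, mul_pow, mul_pow]
  ring

theorem recipPowDiff_nonneg {h c : ℝ} (h0 : 0 ≤ h) (hc : h < c) (n : ℕ) :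
    0 ≤ recipPowDiff n h c := by
  have hc0 : 0 < c := by linarith
  rw [recipPowDiff_eq h0 hc]
  have := one_div_pow_add_nonneg (div_nonneg h0 hc0.le) ((div_lt_one hc0).2 hc) n
  positivity

theorem recipPowDiff_le {h c : ℝ} (h0 : 0 ≤ h) (h1 : h ≤ 1 / 2) (hc : 2 ≤ c) {n : ℕ}
    (hn : 4 ≤ n) : recipPowDiff n h c ≤ 3 * h ^ 2 * (1 / c ^ 2) := by
  have hc0 : 0 < c := by linarith
  rw [recipPowDiff_eq h0 (by linarith)]
  have hx : h / c ≤ 1 / 4 := by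
    rw [div_le_iff₀ hc0]
    linarith
  have hb := mul_le_mul_of_nonneg_left (one_div_pow_add_le (div_nonneg h0 hc0.le) hx hn)
    (show 0 ≤ (1 / c) ^ n by positivity)
  have hq : (1 / c * (3 / 2)) ^ n ≤ (3 / 4) ^ 4 := by
    have : 1 / c ≤ 1 / 2 := one_div_le_one_div_of_le (by norm_num) hc
    exact (pow_le_pow_left₀ (by positivity) (by linarith) n).trans
      (pow_le_pow_of_le_one (by norm_num) (by norm_num) hn)
  rw [mul_pow] at hq
  have hs : 0 ≤ h ^ 2 * (1 / c ^ 2) := by positivity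
  have e : (1 / c) ^ n * (9 * (h / c) ^ 2 * (3 / 2) ^ n) =
      9 * (h ^ 2 * (1 / c ^ 2)) * ((1 / c) ^ n * (3 / 2) ^ n) := by
    rw [div_pow h]
    ring
  norm_num at hq
  rw [e] at hb
  norm_num at hb ⊢
  norm_num at hs
  nlinarith

theorem recipPowDiff_two_le {h c : ℝ} (h0 : 0 ≤ h) (h1 : h ≤ 1 / 2) (hc : 1 ≤ c) :
    recipPowDiff 2 h c ≤ 32 / 3 * h ^ 2 * (1 / c ^ 4) := by
  have hp : c - h ≠ 0 := by linarith
  have hq : c + h ≠ 0 := by linarith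
  have hc0 : c ≠ 0 := by linarith
  have e : recipPowDiff 2 h c = (6 * c ^ 2 * h ^ 2 - 2 * h ^ 4) / (c ^ 2 * (c ^ 2 - h ^ 2) ^ 2) := by
    rw [show c ^ 2 - h ^ 2 = (c - h) * (c + h) by ring, recipPowDiff]
    field_simp
    ring
  have hd : 3 / 4 * c ^ 2 ≤ c ^ 2 - h ^ 2 := by nlinarith
  have hd2 : (3 / 4 * c ^ 2) ^ 2 ≤ (c ^ 2 - h ^ 2) ^ 2 :=
    pow_le_pow_left₀ (by positivity) hd 2
  have hcp : 0 < c ^ 2 := by positivity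
  rw [e, mul_one_div, div_le_div_iff₀ (mul_pos hcp (by nlinarith)) (by positivity)]
  have h4 : 0 ≤ h ^ 4 * c ^ 4 := by positivity
  have h5 := mul_le_mul_of_nonneg_left hd2 (show 0 ≤ h ^ 2 * c ^ 2 by positivity)
  nlinarith

theorem hasSum_one_div_succ_sq :
    HasSum (fun k : ℕ => 1 / ((k : ℝ) + 1) ^ 2) (Real.pi ^ 2 / 6) := by
  simpa using (hasSum_nat_add_iff' 1).2 hasSum_zeta_two

theorem hasSum_one_div_succ_pow_four :
    HasSum (fun k : ℕ => 1 / ((k : ℝ) + 1) ^ 4) (Real.pi ^ 4 / 90) := by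
  simpa using (hasSum_nat_add_iff' 1).2 hasSum_zeta_four

theorem hasSum_one_div_add_two_sq :
    HasSum (fun k : ℕ => 1 / ((k : ℝ) + 2) ^ 2) (Real.pi ^ 2 / 6 - 1) := by
  have := (hasSum_nat_add_iff' 2).2 hasSum_zeta_two
  simpa [Finset.sum_range_succ] using this

theorem summable_recipPowDiff_two {h : ℝ} (h0 : 0 ≤ h) (h1 : h ≤ 1 / 2) :
    Summable fun k : ℕ => recipPowDiff 2 h ((k : ℝ) + 1) :=
  Summable.of_nonneg_of_le
    (fun k => recipPowDiff_nonneg h0 (by linarith [show (0 : ℝ) ≤ k from k.cast_nonneg]) 2)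
    (fun k => recipPowDiff_two_le h0 h1 (by linarith [show (0 : ℝ) ≤ k from k.cast_nonneg]))
    (hasSum_one_div_succ_pow_four.summable.mul_left _)

theorem tsum_recipPowDiff_two_le {h : ℝ} (h0 : 0 ≤ h) (h1 : h ≤ 1 / 2) :
    ∑' k : ℕ, recipPowDiff 2 h ((k : ℝ) + 1) ≤ 32 / 3 * h ^ 2 * (Real.pi ^ 4 / 90) := by
  rw [← hasSum_one_div_succ_pow_four.tsum_eq, ← tsum_mul_left]
  exact Summable.tsum_le_tsum
    (fun k => recipPowDiff_two_le h0 h1 (by linarith [show (0 : ℝ) ≤ k from k.cast_nonneg]))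
    (summable_recipPowDiff_two h0 h1) (hasSum_one_div_succ_pow_four.summable.mul_left _)

theorem summable_recipPowDiff_add_two {h : ℝ} (h0 : 0 ≤ h) (h1 : h ≤ 1 / 2) {n : ℕ}
    (hn : 4 ≤ n) : Summable fun k : ℕ => recipPowDiff n h ((k : ℝ) + 2) :=
  Summable.of_nonneg_of_le
    (fun k => recipPowDiff_nonneg h0 (by linarith [show (0 : ℝ) ≤ k from k.cast_nonneg]) n)
    (fun k => recipPowDiff_le h0 h1 (by linarith [show (0 : ℝ) ≤ k from k.cast_nonneg]) hn)
    (hasSum_one_div_add_two_sq.summable.mul_left _)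

theorem tsum_recipPowDiff_add_two_nonneg {h : ℝ} (h0 : 0 ≤ h) (h1 : h ≤ 1 / 2) (n : ℕ) :
    0 ≤ ∑' k : ℕ, recipPowDiff n h ((k : ℝ) + 2) :=
  tsum_nonneg fun k =>
    recipPowDiff_nonneg h0 (by linarith [show (0 : ℝ) ≤ k from k.cast_nonneg]) n

theorem tsum_recipPowDiff_add_two_le {h : ℝ} (h0 : 0 ≤ h) (h1 : h ≤ 1 / 2) {n : ℕ}
    (hn : 4 ≤ n) : ∑' k : ℕ, recipPowDiff n h ((k : ℝ) + 2) ≤ 3 * h ^ 2 := by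
  have hle : ∑' k : ℕ, recipPowDiff n h ((k : ℝ) + 2) ≤ 3 * h ^ 2 * (Real.pi ^ 2 / 6 - 1) := by
    rw [← hasSum_one_div_add_two_sq.tsum_eq, ← tsum_mul_left]
    exact Summable.tsum_le_tsum
      (fun k => recipPowDiff_le h0 h1 (by linarith [show (0 : ℝ) ≤ k from k.cast_nonneg]) hn)
      (summable_recipPowDiff_add_two h0 h1 hn) (hasSum_one_div_add_two_sq.summable.mul_left _)
  have hpi : Real.pi ^ 2 / 6 - 1 ≤ 1 := by nlinarith [Real.pi_lt_d2, Real.pi_pos]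
  exact hle.trans (mul_le_of_le_one_right (by positivity) hpi)

theorem kapCoef_eq_sub_tsum (j : ℕ) (t : ℝ) :
    kapCoef j t = t ^ (2 * j + 2) -
      (1 / 2) ^ (2 * j + 2) * ∑' k : ℕ, recipPowDiff (2 * j + 2) (t / 2) ((k : ℝ) + 1) := by
  rw [kapCoef, sub_eq_add_neg, ← neg_mul, ← tsum_mul_left]
  congr 2
  ext k
  generalize 2 * j + 2 = n
  have h1 : 2 * ((k : ℝ) + 1) - t = 2 * ((k : ℝ) + 1 - t / 2) := by ring
  have h2 : 2 * ((k : ℝ) + 1) + t = 2 * ((k : ℝ) + 1 + t / 2) := by ring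
  rw [recipPowDiff, h1, h2, mul_pow, mul_pow, mul_pow]
  simp only [one_div, inv_pow]
  ring

theorem two_sub_pow_mul_kapCoef {t : ℝ} (ht : t ∈ Ioo (0 : ℝ) 1) {j : ℕ} (hj : 1 ≤ j) :
    (2 - t) ^ (2 * j + 2) * kapCoef j t = ((2 - t) * t) ^ (2 * j + 2)
      - (1 + ((1 - t / 2) / (1 + t / 2)) ^ (2 * j + 2) - 2 * (1 - t / 2) ^ (2 * j + 2))
      - (1 - t / 2) ^ (2 * j + 2) *
        ∑' k : ℕ, recipPowDiff (2 * j + 2) (t / 2) ((k : ℝ) + 2) := by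
  obtain ⟨h0, h1⟩ := ht
  set n := 2 * j + 2 with hn
  have e : ∀ k : ℕ, (((k + 1 : ℕ) : ℝ) + 1) = (k : ℝ) + 2 := fun k => by
    push_cast
    ring
  have hs : Summable fun k : ℕ => recipPowDiff n (t / 2) ((k : ℝ) + 1) := by
    rw [← summable_nat_add_iff 1]
    simpa only [e] using summable_recipPowDiff_add_two (h := t / 2) (by linarith) (by linarith)
      (show 4 ≤ n by lia)
  have ha : (2 - t) ^ n * (1 / 2) ^ n = (1 - t / 2) ^ n := by
    rw [← mul_pow]
    congr 1
    ring
  have hone : (1 - t / 2) ^ n * recipPowDiff n (t / 2) 1 =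
      1 + ((1 - t / 2) / (1 + t / 2)) ^ n - 2 * (1 - t / 2) ^ n := by
    have hcancel : (1 - t / 2) ^ n * (1 / (1 - t / 2)) ^ n = 1 := by
      rw [← mul_pow, mul_one_div_cancel (by linarith), one_pow]
    rw [recipPowDiff, div_one, one_pow, div_eq_mul_one_div (1 - t / 2), mul_pow]
    linear_combination hcancel
  rw [kapCoef_eq_sub_tsum, hs.tsum_eq_zero_add, ← hn]
  simp only [e, Nat.cast_zero, zero_add]
  rw [mul_sub, ← mul_assoc, ha, mul_add, hone, mul_pow]
  ring

theorem two_sub_pow_mul_kapCoef_succ_lt {t : ℝ} (ht : t ∈ Ioo (0 : ℝ) 1) {j : ℕ}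
    (hj : 1 ≤ j) :
    (2 - t) ^ (2 * (j + 1) + 2) * kapCoef (j + 1) t < (2 - t) ^ (2 * j + 2) * kapCoef j t := by
  rw [two_sub_pow_mul_kapCoef ht hj, two_sub_pow_mul_kapCoef ht (by lia)]
  obtain ⟨h0, h1⟩ := ht
  obtain ⟨h, rfl⟩ : ∃ h, t = 2 * h := ⟨t / 2, by ring⟩
  rw [mul_div_cancel_left₀ h two_ne_zero, show 2 * (j + 1) + 2 = (2 * j + 2) + 2 by ring]
  have hn : 4 ≤ 2 * j + 2 := by lia
  generalize 2 * j + 2 = n at hn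
  have hh0 : 0 < h := by linarith
  have hS := tsum_recipPowDiff_add_two_le hh0.le (by linarith) hn
  have hS' := tsum_recipPowDiff_add_two_nonneg hh0.le (by linarith) (n + 2)
  set S := ∑' k : ℕ, recipPowDiff n h ((k : ℝ) + 2)
  set S' := ∑' k : ℕ, recipPowDiff (n + 2) h ((k : ℝ) + 2)
  have hst : ((2 - 2 * h) * (2 * h)) ^ (n + 2) ≤ ((2 - 2 * h) * (2 * h)) ^ n :=
    pow_le_pow_of_le_one (mul_nonneg (by linarith) h0.le)
      (by nlinarith [sq_nonneg (1 - 2 * h)]) (by lia)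
  have ha : 0 < (1 - h) ^ n := pow_pos (by linarith) _
  have hb : 1 - ((1 - h) / (1 + h)) ^ 2 = 4 * h / (1 + h) ^ 2 := by
    field_simp
    ring
  have hq : (1 / (1 + h)) ^ n ≤ (1 / (1 + h)) ^ 4 :=
    pow_le_pow_of_le_one (by positivity) (by rw [div_le_one (by positivity)]; linarith) hn
  have hmain : (1 / (1 + h)) ^ n * (4 * h / (1 + h) ^ 2) < 2 * (1 - (1 - h) ^ 2) - 3 * h ^ 2 := by
    refine (mul_le_mul_of_nonneg_right hq (by positivity)).trans_lt ?_
    have : (1 / (1 + h)) ^ 4 * (4 * h / (1 + h) ^ 2) = 4 * h / (1 + h) ^ 6 := by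
      field_simp
    rw [this, div_lt_iff₀ (by positivity)]
    have h6 : 1 + 6 * h + 15 * h ^ 2 ≤ (1 + h) ^ 6 := by
      have : (1 + h) ^ 6 = 1 + 6 * h + 15 * h ^ 2 +
        (20 * h ^ 3 + 15 * h ^ 4 + 6 * h ^ 5 + h ^ 6) := by ring
      rw [this]
      exact le_add_of_nonneg_right (by positivity)
    have hpos : 4 < (4 - 5 * h) * (1 + 6 * h + 15 * h ^ 2) := by
      nlinarith [mul_pos hh0 hh0, mul_pos (mul_pos hh0 hh0) (show 0 < 1 / 2 - h by linarith)]
    calc 4 * h < h * ((4 - 5 * h) * (1 + 6 * h + 15 * h ^ 2)) := by nlinarith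
      _ ≤ h * ((4 - 5 * h) * (1 + h) ^ 6) :=
        mul_le_mul_of_nonneg_left (mul_le_mul_of_nonneg_left h6 (by linarith)) hh0.le
      _ = _ := by ring
  have hkey := mul_lt_mul_of_pos_left hmain ha
  have hSa := mul_le_mul_of_nonneg_left hS ha.le
  have hSa' : 0 ≤ (1 - h) ^ (n + 2) * S' := mul_nonneg (pow_nonneg (by linarith) _) hS'
  have hbn : ((1 - h) / (1 + h)) ^ n - ((1 - h) / (1 + h)) ^ (n + 2) =
      (1 - h) ^ n * ((1 / (1 + h)) ^ n * (4 * h / (1 + h) ^ 2)) := by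
    rw [← hb, pow_add, ← mul_assoc, ← mul_pow, mul_one_div]
    ring
  have han : (1 - h) ^ (n + 2) = (1 - h) ^ n * (1 - h) ^ 2 := pow_add _ _ _
  nlinarith

theorem tendsto_two_sub_pow_mul_kapCoef {t : ℝ} (ht : t ∈ Ioo (0 : ℝ) 1) :
    Tendsto (fun j : ℕ => (2 - t) ^ (2 * j + 2) * kapCoef j t) atTop (nhds (-1)) := by
  have h0 := ht.1
  have h1 := ht.2
  have hidx : Tendsto (fun j : ℕ => 2 * j + 2) atTop atTop :=
    tendsto_atTop_mono (fun j => show j ≤ 2 * j + 2 by lia) tendsto_id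
  have hst : Tendsto (fun j : ℕ => ((2 - t) * t) ^ (2 * j + 2)) atTop (nhds 0) :=
    (tendsto_pow_atTop_nhds_zero_of_lt_one (mul_nonneg (by linarith) h0.le)
      (by nlinarith [mul_pos (sub_pos.2 h1) (sub_pos.2 h1)])).comp hidx
  have hb : Tendsto (fun j : ℕ => ((1 - t / 2) / (1 + t / 2)) ^ (2 * j + 2)) atTop (nhds 0) :=
    (tendsto_pow_atTop_nhds_zero_of_lt_one (div_nonneg (by linarith) (by linarith))
      (by rw [div_lt_one (by linarith)]; linarith)).comp hidx
  have ha : Tendsto (fun j : ℕ => (1 - t / 2) ^ (2 * j + 2)) atTop (nhds 0) :=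
    (tendsto_pow_atTop_nhds_zero_of_lt_one (by linarith) (by linarith)).comp hidx
  have hS : Tendsto (fun j : ℕ => (1 - t / 2) ^ (2 * j + 2) *
      ∑' k : ℕ, recipPowDiff (2 * j + 2) (t / 2) ((k : ℝ) + 2)) atTop (nhds 0) := by
    have hmul := ha.mul_const (3 * (t / 2) ^ 2)
    rw [zero_mul] at hmul
    refine tendsto_of_tendsto_of_tendsto_of_le_of_le' tendsto_const_nhds hmul
      (Eventually.of_forall fun j => ?_) ?_
    · exact mul_nonneg (pow_nonneg (by linarith) _)
        (tsum_recipPowDiff_add_two_nonneg (by linarith) (by linarith) _)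
    · filter_upwards [eventually_ge_atTop 1] with j hj
      exact mul_le_mul_of_nonneg_left
        (tsum_recipPowDiff_add_two_le (by linarith) (by linarith) (by lia))
        (pow_nonneg (by linarith) _)
  have hlim := (hst.sub ((hb.const_add 1).sub (ha.const_mul 2))).sub hS
  norm_num at hlim
  refine hlim.congr' ?_
  filter_upwards [eventually_ge_atTop 1] with j hj
  rw [two_sub_pow_mul_kapCoef ht hj]

theorem summable_and_tsum_one_div_sub_add {x : ℝ} (hx : x ∈ Ioo (0 : ℝ) (1 / 2)) :
    Summable (fun n : ℕ => 1 / (x - ((n : ℝ) + 1)) + 1 / (x + ((n : ℝ) + 1))) ∧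
    ∑' n : ℕ, (1 / (x - ((n : ℝ) + 1)) + 1 / (x + ((n : ℝ) + 1))) =
      Real.pi * Real.cot (Real.pi * x) - 1 / x := by
  have hz : (x : ℂ) ∈ Complex.integerComplement := by
    rintro ⟨m, hm⟩
    have hm' : (m : ℝ) = x := by exact_mod_cast hm
    have h1 : (0 : ℝ) < m := hm' ▸ hx.1
    have h2 : (m : ℝ) < 1 := by linarith [hx.2]
    norm_cast at h1 h2
    lia
  have hs := summable_cotTerm hz
  have ht := cot_series_rep' hz
  simp only [cotTerm] at hs
  norm_cast at hs ht
  push_cast at hs ht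
  exact ⟨hs, ht.symm⟩

theorem hasSum_one_div_sq_sub_add {x : ℝ} (hx : x ∈ Ioo (0 : ℝ) (1 / 2)) :
    HasSum (fun n : ℕ => 1 / ((n : ℝ) + 1 - x) ^ 2 + 1 / ((n : ℝ) + 1 + x) ^ 2)
      (Real.pi ^ 2 / Real.sin (Real.pi * x) ^ 2 - 1 / x ^ 2) := by
  have hsub : ∀ (n : ℕ), ∀ y ∈ Ioo (0 : ℝ) (1 / 2), ((n : ℝ) + 1) / 2 ≤ (n : ℝ) + 1 - y :=
    fun n y hy => by linarith [hy.2, show (0 : ℝ) ≤ n from n.cast_nonneg]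
  have hbound : ∀ (n : ℕ), ∀ y ∈ Ioo (0 : ℝ) (1 / 2),
      1 / ((n : ℝ) + 1 - y) ^ 2 + 1 / ((n : ℝ) + 1 + y) ^ 2 ≤ 8 * (1 / ((n : ℝ) + 1) ^ 2) := by
    intro n y hy
    have hn : 0 < (n : ℝ) + 1 := by positivity
    have h1 : 1 / ((n : ℝ) + 1 - y) ^ 2 ≤ 1 / (((n : ℝ) + 1) / 2) ^ 2 :=
      one_div_le_one_div_of_le (by positivity)
        (pow_le_pow_left₀ (by positivity) (hsub n y hy) 2)
    have h2 : 1 / ((n : ℝ) + 1 + y) ^ 2 ≤ 1 / (((n : ℝ) + 1) / 2) ^ 2 :=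
      one_div_le_one_div_of_le (by positivity)
        (pow_le_pow_left₀ (by positivity) (by linarith [hy.1]) 2)
    have e : 1 / (((n : ℝ) + 1) / 2) ^ 2 = 4 * (1 / ((n : ℝ) + 1) ^ 2) := by
      field_simp
      norm_num
    linarith
  have hnonneg : ∀ (n : ℕ) (y : ℝ),
      0 ≤ 1 / ((n : ℝ) + 1 - y) ^ 2 + 1 / ((n : ℝ) + 1 + y) ^ 2 := fun n y => by positivity
  have hu : Summable fun n : ℕ => 8 * (1 / ((n : ℝ) + 1) ^ 2) :=
    hasSum_one_div_succ_sq.summable.mul_left 8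
  have hterm : ∀ (n : ℕ), ∀ y ∈ Ioo (0 : ℝ) (1 / 2),
      HasDerivAt (fun y : ℝ => 1 / (y - ((n : ℝ) + 1)) + 1 / (y + ((n : ℝ) + 1)))
        (-(1 / ((n : ℝ) + 1 - y) ^ 2 + 1 / ((n : ℝ) + 1 + y) ^ 2)) y := by
    intro n y hy
    have hn : 0 < (n : ℝ) + 1 := by positivity
    have h1 : y - ((n : ℝ) + 1) ≠ 0 := by linarith [hsub n y hy]
    have h2 : y + ((n : ℝ) + 1) ≠ 0 := by linarith [hy.1]
    have hd := (((hasDerivAt_id y).sub_const ((n : ℝ) + 1)).fun_inv h1).fun_add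
      (((hasDerivAt_id y).add_const ((n : ℝ) + 1)).fun_inv h2)
    simp only [id, ← one_div] at hd
    refine hd.congr_deriv ?_
    rw [show ((n : ℝ) + 1 - y) ^ 2 = (y - ((n : ℝ) + 1)) ^ 2 by ring, add_comm _ y]
    ring
  have hderiv := hasDerivAt_tsum_of_isPreconnected hu isOpen_Ioo isPreconnected_Ioo hterm
    (fun n y hy => by
      rw [norm_neg, Real.norm_of_nonneg (hnonneg n y)]
      exact hbound n y hy) hx (summable_and_tsum_one_div_sub_add hx).1 hx
  have hsin : Real.sin (Real.pi * x) ≠ 0 :=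
    (Real.sin_pos_of_pos_of_lt_pi (mul_pos Real.pi_pos hx.1)
      (by nlinarith [hx.2, Real.pi_pos])).ne'
  have hlin : HasDerivAt (fun y : ℝ => Real.pi * y) Real.pi x := by
    simpa using (hasDerivAt_id x).const_mul Real.pi
  have hcot : HasDerivAt (fun y : ℝ => Real.pi * Real.cot (Real.pi * y) - 1 / y)
      (-(Real.pi ^ 2 / Real.sin (Real.pi * x) ^ 2 - 1 / x ^ 2)) x := by
    simp only [Real.cot_eq_cos_div_sin, one_div]
    refine (((hlin.cos.fun_div hlin.sin hsin).const_mul Real.pi).fun_sub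
      (hasDerivAt_inv hx.1.ne')).congr_deriv ?_
    have hx0 := hx.1.ne'
    have hcs := Real.sin_sq_add_cos_sq (Real.pi * x)
    field_simp
    linear_combination -(x ^ 2 * Real.pi ^ 2) * hcs
  have heq := hderiv.unique (hcot.congr_of_eventuallyEq
    ((isOpen_Ioo.eventually_mem hx).mono fun y hy => (summable_and_tsum_one_div_sub_add hy).2))
  rw [tsum_neg, neg_inj] at heq
  rw [← heq]
  exact (hu.of_nonneg_of_le (fun n => hnonneg n x) fun n => hbound n x hx).hasSum

theorem kapCoef_zero_eq {t : ℝ} (ht : t ∈ Ioo (0 : ℝ) 1) :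
    kapCoef 0 t = Real.pi ^ 2 / 12 + 1 / t ^ 2
        - (Real.pi ^ 2 / 4) / (Real.sin (Real.pi * t / 2)) ^ 2 + t ^ 2 := by
  have hx : t / 2 ∈ Ioo (0 : ℝ) (1 / 2) := ⟨by linarith [ht.1], by linarith [ht.2]⟩
  have hsum := (hasSum_one_div_sq_sub_add hx).sub (hasSum_one_div_succ_sq.mul_left 2)
  simp only [← one_div_pow] at hsum
  have hsum' := hsum.tsum_eq
  simp only [← recipPowDiff.eq_1] at hsum'
  rw [kapCoef_eq_sub_tsum, mul_zero, zero_add, hsum', ← mul_div_assoc]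
  ring

theorem kapCoef_zero_pos {t : ℝ} (ht : t ∈ Ioo (0 : ℝ) 1) : 0 < kapCoef 0 t := by
  have h := tsum_recipPowDiff_two_le (h := t / 2) (by linarith [ht.1]) (by linarith [ht.2])
  have hpi : Real.pi ^ 4 / 90 < 1.1 := by
    have h2 : Real.pi ^ 2 < 9.93 := by nlinarith [Real.pi_lt_d2, Real.pi_pos]
    nlinarith [sq_nonneg Real.pi]
  have ht2 : 0 < t ^ 2 := pow_pos ht.1 2
  rw [kapCoef_eq_sub_tsum, mul_zero, zero_add]
  nlinarith

/-- For `t ∈ (0,1)`: (i) the explicit formula for `κ₀(t)` and its positivity;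
(ii) the sequence `j ↦ (2-t)^{2j+2} κ_j(t)` is strictly decreasing for `j ≥ 1` with limit
`-1`; (iii) the sequence `(κ_j(t))_j` changes sign at most once, from `≥ 0` to `≤ 0`. -/
theorem kapCoef_sign_structure (t : ℝ) (ht : t ∈ Ioo (0 : ℝ) 1) :
    (kapCoef 0 t = Real.pi ^ 2 / 12 + 1 / t ^ 2
        - (Real.pi ^ 2 / 4) / (Real.sin (Real.pi * t / 2)) ^ 2 + t ^ 2 ∧
      0 < kapCoef 0 t) ∧
    (∀ j k : ℕ, 1 ≤ j → j < k →
      (2 - t) ^ (2 * k + 2) * kapCoef k t < (2 - t) ^ (2 * j + 2) * kapCoef j t) ∧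
    Tendsto (fun j : ℕ => (2 - t) ^ (2 * j + 2) * kapCoef j t) atTop (nhds (-1)) ∧
    (∃ j₀ : ℕ, (∀ j ≤ j₀, 0 ≤ kapCoef j t) ∧ ∀ j : ℕ, j₀ < j → kapCoef j t ≤ 0) := by
  have hanti : ∀ j k : ℕ, 1 ≤ j → j < k →
      (2 - t) ^ (2 * k + 2) * kapCoef k t < (2 - t) ^ (2 * j + 2) * kapCoef j t := by
    intro j k hj hjk
    induction k, hjk using Nat.le_induction with
    | base => exact two_sub_pow_mul_kapCoef_succ_lt ht hj
    | succ k hk ih => exact (two_sub_pow_mul_kapCoef_succ_lt ht (by lia)).trans ih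
  have hlim := tendsto_two_sub_pow_mul_kapCoef ht
  have hpow : ∀ j : ℕ, 0 < (2 - t) ^ (2 * j + 2) := fun j => pow_pos (by linarith [ht.2]) _
  refine ⟨⟨kapCoef_zero_eq ht, kapCoef_zero_pos ht⟩, hanti, hlim, ?_⟩
  classical
  have hex : ∃ j, kapCoef j t < 0 := by
    obtain ⟨j, hj⟩ := (hlim.eventually (gt_mem_nhds (show (-1 : ℝ) < 0 by norm_num))).exists
    exact ⟨j, (pos_iff_neg_of_mul_neg hj).1 (hpow j)⟩
  have hneg := Nat.find_spec hex
  have hN : Nat.find hex ≠ 0 := fun h0 => by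
    rw [h0] at hneg
    exact lt_asymm hneg (kapCoef_zero_pos ht)
  refine ⟨Nat.find hex - 1, fun j hj => not_lt.1 (Nat.find_min hex (by lia)), fun j hj => ?_⟩
  rcases (show Nat.find hex ≤ j by lia).eq_or_lt with h | h
  · exact h ▸ hneg.le
  · have hlt := (hanti _ j (by lia) h).trans (mul_neg_of_pos_of_neg (hpow _) hneg)
    exact ((pos_iff_neg_of_mul_neg hlt).1 (hpow j)).le
end

section
/- For j,k ∈ ℕ, define b_{j,k} := (2j+2k+3)!·ζ(2j+2k+4) / (2^{2j+2k+3}·(2j+2)!·(2k+1)!), where ζ(m) := ∑_{n=1}^{∞} n^{−m} is the Riemann zeta function. Then: (i) for every j ∈ ℕ and every x ∈ (−1,1), T₁(u_j)(x) = ∑_{k=0}^{∞} b_{j,k}·x^{2k+1}, where u_j(t) := t^{2j+1}; (ii) the infinite matrix (b_{j,k})_{j,k≥0} is strictly totally positive: for every r ≥ 1 and all indices j₁ < ⋯ < j_r and k₁ < ⋯ < k_r in ℕ, the determinant of the r×r matrix (b_{j_s,k_t})_{1≤s,t≤r} is strictly positive. -/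
open Set

/-- The matrix entries
`b_{j,k} = (2j+2k+3)! ζ(2j+2k+4) / (2^{2j+2k+3} (2j+2)! (2k+1)!)`, where
`ζ(m) = ∑_{n≥1} n^{-m}`. -/
noncomputable def bmat (j k : ℕ) : ℝ :=
  (Nat.factorial (2 * j + 2 * k + 3) : ℝ) *
      (∑' n : ℕ, (((n : ℝ) + 1) ^ (2 * j + 2 * k + 4))⁻¹) /
    (2 ^ (2 * j + 2 * k + 3) * (Nat.factorial (2 * j + 2) : ℝ) *
      (Nat.factorial (2 * k + 1) : ℝ))

open Polynomial in
lemma Polynomial.signVariations_lt_card_support {P : ℝ[X]} (hP : P ≠ 0) :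
    P.signVariations < P.support.card := by
  induction hn : P.support.card generalizing P with
  | zero => simp_all
  | succ n ih =>
    by_cases hQ : P.eraseLead = 0
    · have := signVariations_eq_eraseLead_add_ite hP
      have h0 : SignType.sign P.leadingCoeff ≠ 0 := by simpa using hP
      simp [hQ, h0] at this
      omega
    · have h1 := ih hQ (card_support_eraseLead' hn)
      have h2 := signVariations_le_eraseLead_succ (P := P)
      omega

open Polynomial in
/-- A weak form of Descartes' rule of signs. -/
lemma Polynomial.card_lt_card_support_of_pos_roots {P : ℝ[X]} (hP : P ≠ 0) (s : Finset ℝ)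
    (hs : ∀ x ∈ s, 0 < x ∧ P.eval x = 0) : s.card < P.support.card := by
  refine lt_of_le_of_lt ?_ (signVariations_lt_card_support hP)
  refine le_trans ?_ (roots_countP_pos_le_signVariations P)
  rw [Multiset.countP_eq_card_filter]
  refine Multiset.card_le_card (Multiset.le_iff_subset s.nodup |>.2 fun x hx => ?_)
  have := hs x hx
  simp [hP, this]

open Polynomial in
/-- Generalized Vandermonde determinants with increasing positive nodes are positive. -/
theorem det_generalized_vandermonde_pos {n : ℕ} (x : Fin n → ℝ) (k : Fin n → ℕ)
    (hx : StrictMono x) (hx0 : ∀ i, 0 < x i) (hk : StrictMono k) :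
    0 < (Matrix.of fun i s => x i ^ k s).det := by
  induction n with
  | zero => simp
  | succ n ih =>
    set c : Fin (n + 1) → ℝ := fun j => (-1) ^ (n + (j : ℕ)) *
      (Matrix.of fun i s : Fin n => x i.castSucc ^ k (j.succAbove s)).det with hc
    set P : ℝ[X] := ∑ j, monomial (k j) (c j) with hPdef
    have hev : ∀ y : ℝ, P.eval y =
        (Matrix.of fun (i : Fin (n + 1)) s =>
          (Fin.snoc (α := fun _ => ℝ) (fun i : Fin n => x i.castSucc) y i : ℝ) ^ k s).det := by
      intro y
      rw [Matrix.det_succ_row _ (Fin.last n), hPdef, eval_finsetSum]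
      refine Finset.sum_congr rfl fun j _ => ?_
      simp only [eval_monomial, hc, Matrix.of_apply, Fin.snoc_last, Fin.val_last]
      have : (Matrix.of fun i s : Fin n => x i.castSucc ^ k (j.succAbove s)) =
          (Matrix.of fun (i : Fin (n + 1)) s =>
          (Fin.snoc (α := fun _ => ℝ) (fun i : Fin n => x i.castSucc) y i : ℝ) ^ k s).submatrix
            (Fin.last n).succAbove j.succAbove := by
        ext i s
        simp
      rw [← this]
      ring
    have hclast : 0 < c (Fin.last n) := by
      have := ih (fun i => x i.castSucc) (fun i => k i.castSucc)
        (hx.comp Fin.strictMono_castSucc) (fun i => hx0 _) (hk.comp Fin.strictMono_castSucc)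
      simpa [hc, ← two_mul, pow_mul] using this
    have hcoeff : P.coeff (k (Fin.last n)) = c (Fin.last n) := by
      simp [hPdef, coeff_monomial, hk.injective.eq_iff]
    have hdeg : P.natDegree ≤ k (Fin.last n) := by
      refine natDegree_sum_le_of_forall_le _ _ fun j _ => ?_
      exact (natDegree_monomial_le _).trans (hk.monotone (Fin.le_last j))
    have hdeg' : P.natDegree = k (Fin.last n) :=
      natDegree_eq_of_le_of_coeff_ne_zero hdeg (by rw [hcoeff]; exact hclast.ne')
    have hlead : 0 < P.leadingCoeff := by rwa [leadingCoeff, hdeg', hcoeff]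
    have hP : P ≠ 0 := leadingCoeff_ne_zero.1 hlead.ne'
    have hsupp : P.support.card ≤ n + 1 := by
      have : P.support ⊆ Finset.univ.image k := by
        intro m hm
        rw [mem_support_iff] at hm
        by_contra h
        apply hm
        rw [hPdef, finsetSum_coeff]
        refine Finset.sum_eq_zero fun j _ => ?_
        rw [coeff_monomial, if_neg]
        rintro rfl
        exact h (by simp)
      simpa using (Finset.card_le_card this).trans Finset.card_image_le
    have hroot : ∀ i : Fin n, P.eval (x i.castSucc) = 0 := by
      intro i
      rw [hev]
      exact Matrix.det_zero_of_row_eq (Fin.castSucc_lt_last i).ne (by ext s; simp)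
    have hgoal : (Matrix.of fun i s => x i ^ k s).det = P.eval (x (Fin.last n)) := by
      rw [hev]
      congr 1
      ext i s
      refine Fin.lastCases ?_ (fun i => ?_) i <;> simp
    rw [hgoal]
    by_contra! hneg
    obtain ⟨z, hz, hz0⟩ : ∃ z, x (Fin.last n) ≤ z ∧ P.eval z = 0 := by
      have hd : 0 < P.degree := by
        by_contra! hd
        rw [eq_C_of_degree_le_zero hd, eval_C] at hneg
        rw [eq_C_of_degree_le_zero hd, leadingCoeff_C] at hlead
        linarith
      have ht := P.tendsto_atTop_of_leadingCoeff_nonneg hd hlead.le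
      obtain ⟨b, hb, hb'⟩ := ((ht.eventually_ge_atTop 0).and
        (Filter.eventually_ge_atTop (x (Fin.last n)))).exists
      obtain ⟨z, hz, hz'⟩ := intermediate_value_Icc hb' P.continuous.continuousOn ⟨hneg, hb⟩
      exact ⟨z, hz.1, hz'⟩
    have hzlt : ∀ i : Fin n, x i.castSucc < z := fun i =>
      (hx (Fin.castSucc_lt_last i)).trans_le hz
    have := card_lt_card_support_of_pos_roots hP
      (insert z (Finset.univ.image fun i : Fin n => x i.castSucc)) (by
        intro w hw
        simp only [Finset.mem_insert, Finset.mem_image, Finset.mem_univ, true_and] at hw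
        rcases hw with rfl | ⟨i, rfl⟩
        · exact ⟨(hx0 _).trans_le hz, hz0⟩
        · exact ⟨hx0 _, hroot i⟩)
    rw [Finset.card_insert_of_notMem, Finset.card_image_of_injective] at this
    · simp at this
      omega
    · exact (hx.comp Fin.strictMono_castSucc).injective
    · simp only [Finset.mem_image, Finset.mem_univ, true_and, not_exists]
      exact fun i => (hzlt i).ne

/-- For positive nodes, two generalized Vandermonde determinants with increasing exponents have
the same sign. -/
lemma det_generalized_vandermonde_mul_nonneg {n : ℕ} (x : Fin n → ℝ) (k l : Fin n → ℕ)
    (hx0 : ∀ i, 0 < x i) (hk : StrictMono k) (hl : StrictMono l) :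
    0 ≤ (Matrix.of fun i s => x i ^ k s).det * (Matrix.of fun i s => x i ^ l s).det := by
  by_cases hx : Function.Injective x
  · set σ := Tuple.sort x
    have hσ : StrictMono (x ∘ σ) :=
      (Tuple.monotone_sort x).strictMono_of_injective (hx.comp σ.injective)
    have key : ∀ k : Fin n → ℕ, StrictMono k →
        0 < (Equiv.Perm.sign σ : ℝ) * (Matrix.of fun i s => x i ^ k s).det := by
      intro k hk
      rw [← Matrix.det_permute]
      exact det_generalized_vandermonde_pos (x ∘ σ) k hσ (fun i => hx0 _) hk
    have h := mul_pos (key k hk) (key l hl)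
    rcases Int.units_eq_one_or (Equiv.Perm.sign σ) with h1 | h1 <;> simp [h1] at h <;> exact h.le
  · obtain ⟨i, j, hij, hne⟩ : ∃ i j, x i = x j ∧ i ≠ j := by
      simpa [Function.Injective] using hx
    rw [Matrix.det_zero_of_row_eq hne (by ext s; simp [hij]), zero_mul]

open MeasureTheory in
/-- Andréief's identity. -/
theorem det_integral_mul {α : Type*} [MeasurableSpace α] (μ : Measure α) [SigmaFinite μ] {n : ℕ}
    (f g : Fin n → α → ℝ) (hfg : ∀ s t, Integrable (fun a => f s a * g t a) μ) :
    Integrable (fun y : Fin n → α => (Matrix.of fun i s => f s (y i)).det *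
      (Matrix.of fun i t => g t (y i)).det) (Measure.pi fun _ => μ) ∧
    ∫ y : Fin n → α, (Matrix.of fun i s => f s (y i)).det *
      (Matrix.of fun i t => g t (y i)).det ∂(Measure.pi fun _ => μ) =
    n.factorial * (Matrix.of fun s t => ∫ a, f s a * g t a ∂μ).det := by
  have hexp : ∀ y : Fin n → α, (Matrix.of fun i s => f s (y i)).det *
      (Matrix.of fun i t => g t (y i)).det = ∑ τ : Equiv.Perm (Fin n), ∑ σ : Equiv.Perm (Fin n),
        ((Equiv.Perm.sign τ : ℝ) * (Equiv.Perm.sign σ : ℝ)) *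
          ∏ i, (f (σ i) (y i) * g (τ i) (y i)) := by
    intro y
    rw [← Matrix.det_transpose, ← Matrix.det_transpose (Matrix.of fun i t => g t (y i)),
      Matrix.det_apply', Matrix.det_apply', mul_comm, Finset.sum_mul_sum]
    refine Finset.sum_congr rfl fun τ _ => Finset.sum_congr rfl fun σ _ => ?_
    simp only [Matrix.transpose_apply, Matrix.of_apply, Finset.prod_mul_distrib]
    ring
  have hint : ∀ σ τ : Equiv.Perm (Fin n), Integrable (fun y : Fin n → α =>
      ((Equiv.Perm.sign τ : ℝ) * (Equiv.Perm.sign σ : ℝ)) *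
        ∏ i, (f (σ i) (y i) * g (τ i) (y i))) (Measure.pi fun _ => μ) := fun σ τ =>
    (Integrable.fintype_prod (f := fun i a => f (σ i) a * g (τ i) a)
      fun i => hfg (σ i) (τ i)).const_mul _
  simp_rw [hexp]
  refine ⟨integrable_finsetSum _ fun τ _ => integrable_finsetSum _ fun σ _ => hint σ τ, ?_⟩
  rw [integral_finsetSum _ fun τ _ => integrable_finsetSum _ fun σ _ => hint σ τ]
  have hτ : ∀ τ : Equiv.Perm (Fin n), ∫ y : Fin n → α, ∑ σ : Equiv.Perm (Fin n),
        ((Equiv.Perm.sign τ : ℝ) * (Equiv.Perm.sign σ : ℝ)) *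
          ∏ i, (f (σ i) (y i) * g (τ i) (y i)) ∂(Measure.pi fun _ => μ) =
      (Matrix.of fun s t => ∫ a, f s a * g t a ∂μ).det := by
    intro τ
    rw [integral_finsetSum _ fun σ _ => hint σ τ]
    have hdet := Matrix.det_permute' τ (Matrix.of fun s t => ∫ a, f s a * g t a ∂μ)
    have hsq : (Equiv.Perm.sign τ : ℝ) * (Equiv.Perm.sign τ : ℝ) = 1 := by
      rcases Int.units_eq_one_or (Equiv.Perm.sign τ) with h1 | h1 <;> simp [h1]
    calc _ = (Equiv.Perm.sign τ : ℝ) *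
          ((Matrix.of fun s t => ∫ a, f s a * g t a ∂μ).submatrix id τ).det := by
          rw [Matrix.det_apply', Finset.mul_sum]
          refine Finset.sum_congr rfl fun σ _ => ?_
          rw [integral_const_mul,
            integral_fintype_prod_eq_prod (f := fun i a => f (σ i) a * g (τ i) a)]
          simp [mul_assoc]
      _ = _ := by rw [hdet, ← mul_assoc, hsq, one_mul]
  simp [hτ, Fintype.card_perm]

open MeasureTheory in
lemma integral_pow_mul_exp_neg_mul_Ioi (n : ℕ) {c : ℝ} (hc : 0 < c) :
    ∫ t in Ioi (0 : ℝ), t ^ n * Real.exp (-(c * t)) = n.factorial * (c ^ (n + 1))⁻¹ := by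
  have h := Real.integral_rpow_mul_exp_neg_mul_Ioi (a := n + 1) (by positivity) hc
  rw [Real.Gamma_nat_eq_factorial] at h
  simp only [add_sub_cancel_right, Real.rpow_natCast] at h
  rw [h, ← Nat.cast_add_one, Real.rpow_natCast]
  simp [mul_comm]

lemma summable_inv_natCast_add_one_pow {m : ℕ} (hm : 2 ≤ m) :
    Summable fun n : ℕ => (((n : ℝ) + 1) ^ m)⁻¹ := by
  have := (summable_nat_add_iff 1).2 (Real.summable_nat_pow_inv.2 (show 1 < m by omega))
  simpa using this

open MeasureTheory in
/-- The integral representation `∫₀^∞ tⁿ / (eᵗ - 1) dt = n! ζ(n + 1)`. -/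
lemma integral_pow_mul_inv_exp_sub_one_Ioi {n : ℕ} (hn : 1 ≤ n) :
    ∫ t in Ioi (0 : ℝ), t ^ n * (Real.exp t - 1)⁻¹ =
      n.factorial * ∑' i : ℕ, (((i : ℝ) + 1) ^ (n + 1))⁻¹ := by
  set F : ℕ → ℝ → ℝ := fun i t => t ^ n * Real.exp (-(((i : ℝ) + 1) * t))
  have hF : ∀ i, ∫ t in Ioi (0 : ℝ), F i t = n.factorial * (((i : ℝ) + 1) ^ (n + 1))⁻¹ :=
    fun i => integral_pow_mul_exp_neg_mul_Ioi n (by positivity)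
  have hFint : ∀ i, Integrable (F i) (volume.restrict (Ioi 0)) := fun i =>
    Integrable.of_integral_ne_zero (by rw [hF]; positivity)
  have hnorm : ∀ i, ∫ t in Ioi (0 : ℝ), ‖F i t‖ = n.factorial * (((i : ℝ) + 1) ^ (n + 1))⁻¹ := by
    intro i
    rw [← hF]
    refine setIntegral_congr_fun measurableSet_Ioi fun t ht => ?_
    have : (0 : ℝ) < t := ht
    exact Real.norm_of_nonneg (by positivity)
  have h := hasSum_integral_of_summable_integral_norm hFint (by
    simp_rw [hnorm]
    exact (summable_inv_natCast_add_one_pow (by omega)).mul_left _)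
  simp_rw [hF] at h
  rw [← tsum_mul_left, h.tsum_eq]
  refine setIntegral_congr_fun measurableSet_Ioi fun t ht => ?_
  have ht : (0 : ℝ) < t := ht
  have hlt : Real.exp (-t) < 1 := by simpa using ht
  have hgeo := ((hasSum_geometric_of_lt_one (Real.exp_pos (-t)).le hlt).mul_left
    (t ^ n * Real.exp (-t))).tsum_eq
  have hFt : ∀ i, F i t = t ^ n * Real.exp (-t) * Real.exp (-t) ^ i := by
    intro i
    simp only [F]
    rw [← Real.exp_nat_mul, mul_assoc, ← Real.exp_add]
    congr 2
    ring
  simp_rw [hFt, hgeo]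
  have h1 : Real.exp t - 1 ≠ 0 := by
    have := Real.one_lt_exp_iff.2 ht
    linarith
  rw [Real.exp_neg]
  have h2 := Real.exp_ne_zero t
  rw [mul_assoc, ← mul_inv, mul_sub, mul_inv_cancel₀ h2, mul_one]

open MeasureTheory in
/-- Strict positivity of moment determinants `det (∫ t^(k s + l t) w)` on the half-line. -/
theorem det_moment_pos (w : ℝ → ℝ) (hw : ∀ t, 0 < t → 0 < w t) {n : ℕ} (k l : Fin n → ℕ)
    (hk : StrictMono k) (hl : StrictMono l)
    (hint : ∀ s t, IntegrableOn (fun a => a ^ (k s + l t) * w a) (Ioi 0)) :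
    0 < (Matrix.of fun s t => ∫ a in Ioi (0 : ℝ), a ^ (k s + l t) * w a).det := by
  set μ : Measure ℝ := volume.restrict (Ioi 0) with hμ
  have hfun : ∀ s t, (fun a : ℝ => a ^ (k s + l t) * w a) =
      fun a => (w a * a ^ k s) * a ^ l t := by
    intro s t
    ext a
    ring
  simp_rw [IntegrableOn, hfun] at hint
  obtain ⟨hI, hE⟩ := det_integral_mul μ (fun s a => w a * a ^ k s) (fun t a => a ^ l t) hint
  have hdet : ∀ y : Fin n → ℝ, (Matrix.of fun i s => w (y i) * y i ^ k s).det *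
      (Matrix.of fun i t => y i ^ l t).det = (∏ i, w (y i)) *
        ((Matrix.of fun i s => y i ^ k s).det * (Matrix.of fun i t => y i ^ l t).det) := by
    intro y
    rw [← mul_assoc, ← Matrix.det_mul_column]
    rfl
  have hpos : 0 < ∫ y : Fin n → ℝ, (Matrix.of fun i s => w (y i) * y i ^ k s).det *
      (Matrix.of fun i t => y i ^ l t).det ∂(Measure.pi fun _ => μ) := by
    rw [integral_pos_iff_support_of_nonneg_ae _ hI]
    · refine lt_of_lt_of_le ?_ (measure_mono (s := univ.pi fun i : Fin n =>
        Ioo ((i : ℝ) + 1) ((i : ℝ) + 2)) fun y hy => ?_)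
      · rw [Measure.pi_pi, CanonicallyOrderedAdd.prod_pos]
        intro i _
        rw [hμ, Measure.restrict_apply measurableSet_Ioo, inter_eq_left.2, Real.volume_Ioo]
        · norm_num
        · exact fun t ht => lt_trans (by positivity) ht.1
      · simp only [mem_pi, mem_univ, mem_Ioo, true_imp_iff] at hy
        have hy0 : ∀ i, 0 < y i := fun i => lt_trans (by positivity) (hy i).1
        have hmono : StrictMono y := by
          intro i j hij
          have : (i : ℝ) + 1 ≤ j := by exact_mod_cast hij
          linarith [(hy i).2, (hy j).1]
        rw [Function.mem_support, hdet]
        exact (mul_pos (Finset.prod_pos fun i _ => hw _ (hy0 i))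
          (mul_pos (det_generalized_vandermonde_pos y k hmono hy0 hk)
            (det_generalized_vandermonde_pos y l hmono hy0 hl))).ne'
    · have hae : ∀ᵐ y ∂(Measure.pi fun _ : Fin n => μ), ∀ i, 0 < y i :=
        Filter.eventually_all.2 fun i => (Measure.tendsto_eval_ae_ae (i := i)).eventually
          (ae_restrict_mem (measurableSet_Ioi (a := (0 : ℝ))))
      filter_upwards [hae] with y hy
      simp only [Pi.zero_apply, hdet]
      exact mul_nonneg (Finset.prod_nonneg fun i _ => (hw _ (hy i)).le)
        (det_generalized_vandermonde_mul_nonneg y k l hy hk hl)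
  rw [hE] at hpos
  simp_rw [hfun]
  exact pos_of_mul_pos_right hpos (by positivity)

lemma det_bmat_pos {r : ℕ} (jj kk : Fin r → ℕ) (hj : StrictMono jj) (hk : StrictMono kk) :
    0 < Matrix.det (Matrix.of fun s t : Fin r => bmat (jj s) (kk t)) := by
  have hI : ∀ s t, ∫ a in Ioi (0 : ℝ), a ^ (2 * jj s + 2 * kk t) * (a ^ 3 * (Real.exp a - 1)⁻¹) =
      (2 * jj s + 2 * kk t + 3).factorial *
        ∑' i : ℕ, (((i : ℝ) + 1) ^ (2 * jj s + 2 * kk t + 4))⁻¹ := by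
    intro s t
    rw [← integral_pow_mul_inv_exp_sub_one_Ioi (by omega)]
    simp_rw [← mul_assoc, ← pow_add]
  have hpos : ∀ m, 2 ≤ m → 0 < ∑' i : ℕ, (((i : ℝ) + 1) ^ m)⁻¹ := fun m hm =>
    (summable_inv_natCast_add_one_pow hm).tsum_pos (fun i => by positivity) 0 (by positivity)
  have h := det_moment_pos (fun a => a ^ 3 * (Real.exp a - 1)⁻¹)
    (fun t ht => mul_pos (by positivity) (inv_pos.2 (by linarith [Real.one_lt_exp_iff.2 ht])))
    (fun s => 2 * jj s) (fun t => 2 * kk t)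
    (fun a b hab => by simpa using hj hab) (fun a b hab => by simpa using hk hab)
    (fun s t => MeasureTheory.Integrable.of_integral_ne_zero (by
      rw [hI]
      exact (mul_pos (by positivity) (hpos _ (by omega))).ne'))
  simp_rw [hI] at h
  have hb : (Matrix.of fun s t : Fin r => bmat (jj s) (kk t)) =
      Matrix.of fun s t => ((2 ^ (2 * jj s + 2) * (2 * jj s + 2).factorial : ℝ)⁻¹) *
        (Matrix.of fun s t => ((2 ^ (2 * kk t + 1) * (2 * kk t + 1).factorial : ℝ)⁻¹) *
          (Matrix.of fun s t => ((2 * jj s + 2 * kk t + 3).factorial *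
        ∑' i : ℕ, (((i : ℝ) + 1) ^ (2 * jj s + 2 * kk t + 4))⁻¹ : ℝ)) s t) s t := by
    ext s t
    simp only [Matrix.of_apply, bmat]
    rw [show 2 * jj s + 2 * kk t + 3 = (2 * jj s + 2) + (2 * kk t + 1) by ring, pow_add (2 : ℝ)]
    field_simp
  rw [hb, Matrix.det_mul_column, Matrix.det_mul_row]
  exact mul_pos (Finset.prod_pos fun i _ => by positivity)
    (mul_pos (Finset.prod_pos fun i _ => by positivity) h)

/-- Expansion of the contribution of the pair `±a` to `T₁ u_j`. -/
lemma hasSum_inv_sub_pow_sub_inv_add_pow (j : ℕ) {a x : ℝ} (hxa : |x| < a) :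
    HasSum (fun k : ℕ => 2 * ((2 * j + 2 * k + 3).factorial : ℝ) /
        ((2 * j + 2).factorial * (2 * k + 1).factorial) * x ^ (2 * k + 1) *
          (a ^ (2 * j + 2 * k + 4))⁻¹)
      (((a - x) ^ (2 * j + 3))⁻¹ - ((a + x) ^ (2 * j + 3))⁻¹) := by
  have ha : 0 < a := (abs_nonneg x).trans_lt hxa
  have hy : ‖x / a‖ < 1 := by
    rwa [Real.norm_eq_abs, abs_div, abs_of_pos ha, div_lt_one ha]
  have hlt := abs_lt.1 hxa
  have h1 := hasSum_choose_mul_geometric_of_norm_lt_one (2 * j + 2) hy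
  have h2 := hasSum_choose_mul_geometric_of_norm_lt_one (2 * j + 2) (r := -(x / a))
    (by rwa [norm_neg])
  have h := (h1.sub h2).mul_left (a ^ (2 * j + 3))⁻¹
  have hinj : Function.Injective fun k : ℕ => 2 * k + 1 := fun p q h => by
    simpa using h
  rw [← hinj.hasSum_iff] at h
  · convert! h using 1
    · ext k
      have hodd : Odd (2 * k + 1) := ⟨k, rfl⟩
      have hch := Nat.add_choose_mul_factorial_mul_factorial (2 * k + 1) (2 * j + 2)
      have hch' : ((2 * j + 2 * k + 3).factorial : ℝ) =
        (2 * k + 1 + (2 * j + 2)).choose (2 * j + 2) * (2 * k + 1).factorial *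
          (2 * j + 2).factorial := by
        rw [show 2 * j + 2 * k + 3 = 2 * k + 1 + (2 * j + 2) by ring]
        exact_mod_cast hch.symm
      simp only [Function.comp_apply, hodd.neg_pow, hch', div_pow]
      rw [show 2 * j + 2 * k + 4 = (2 * j + 3) + (2 * k + 1) by ring, pow_add]
      field_simp
      ring
    · have e1 : a - x ≠ 0 := by linarith
      have e2 : a + x ≠ 0 := by linarith
      rw [show 1 - x / a = (a - x) / a by field_simp, show 1 - -(x / a) = (a + x) / a by
        field_simp; ring, div_pow, div_pow]
      field_simp
  · intro n hn
    have : Even n := by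
      by_contra h
      obtain ⟨m, rfl⟩ := Nat.not_even_iff_odd.1 h
      exact hn ⟨m, rfl⟩
    simp [this.neg_pow]

lemma summable_inv_two_mul_add_pow (m : ℕ) (hm : 2 ≤ m) {x : ℝ} (hx : |x| < 1) :
    Summable fun n : ℕ => ((2 * ((n : ℝ) + 1) + x) ^ m)⁻¹ := by
  have := abs_lt.1 hx
  refine Summable.of_nonneg_of_le (fun n => ?_) (fun n => ?_) (summable_inv_natCast_add_one_pow hm)
  · have : 0 < 2 * ((n : ℝ) + 1) + x := by linarith [(n.cast_nonneg : (0 : ℝ) ≤ n)]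
    positivity
  · have h0 : (0 : ℝ) ≤ n := n.cast_nonneg
    gcongr ?_⁻¹
    exact pow_le_pow_left₀ (by positivity) (by linarith) m

lemma hasSum_Tsub_one_pow (j : ℕ) {x : ℝ} (hx : |x| < 1) :
    HasSum (fun n : ℕ => ((2 * ((n : ℝ) + 1) - x) ^ (2 * j + 3))⁻¹ -
        ((2 * ((n : ℝ) + 1) + x) ^ (2 * j + 3))⁻¹)
      (Tsub 1 (fun t => t ^ (2 * j + 1)) x) := by
  have hs1 := summable_inv_two_mul_add_pow (2 * j + 3) (by omega) hx
  have hs2 := summable_inv_two_mul_add_pow (2 * j + 3) (by omega) (x := -x) (by simpa)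
  set h : ℤ → ℝ := indicator {j | j ≠ 0} fun i : ℤ =>
    (1 / (x + 2 * (i : ℝ)) ^ 2) * (-1 / (x + 2 * (i : ℝ))) ^ (2 * j + 1) with hh
  have hodd : Odd (2 * j + 3) := ⟨j + 1, by ring⟩
  have hodd' : Odd (2 * j + 1) := ⟨j, by ring⟩
  have hval : ∀ y : ℝ, (1 / y ^ 2) * (-1 / y) ^ (2 * j + 1) = -(y ^ (2 * j + 3))⁻¹ := by
    intro y
    rw [neg_div, hodd'.neg_pow, one_div_pow, mul_neg, one_div_mul_one_div, ← pow_add, one_div]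
    ring_nf
  have hT : Tsub 1 (fun t => t ^ (2 * j + 1)) x = ∑' i, h i := by
    rw [hh, ← tsum_subtype]
    rfl
  have hp : ∀ n : ℕ, h ((n : ℤ) + 1) = -((2 * ((n : ℝ) + 1) + x) ^ (2 * j + 3))⁻¹ := by
    intro n
    rw [hh, indicator_of_mem (by simp; omega), hval]
    push_cast
    rw [add_comm]
  have hn : ∀ n : ℕ, h (-((n : ℤ) + 1)) = ((2 * ((n : ℝ) + 1) - x) ^ (2 * j + 3))⁻¹ := by
    intro n
    rw [hh, indicator_of_mem (by simp; omega), hval]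
    push_cast
    rw [show x + 2 * -((n : ℝ) + 1) = -(2 * ((n : ℝ) + 1) - x) by ring, hodd.neg_pow, inv_neg,
      neg_neg]
  have h0 : h 0 = 0 := by simp [hh]
  have H2 : HasSum (fun n : ℕ => h (-((n : ℤ) + 1)))
      (∑' n : ℕ, ((2 * ((n : ℝ) + 1) + -x) ^ (2 * j + 3))⁻¹) := by
    simp_rw [hn, sub_eq_add_neg]
    exact hs2.hasSum
  have H1 : HasSum (fun n : ℕ => h ((n : ℤ) + 1))
      (∑' n : ℕ, -((2 * ((n : ℝ) + 1) + x) ^ (2 * j + 3))⁻¹) := by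
    simp_rw [hp]
    exact hs1.neg.hasSum
  rw [hT, (H1.of_add_one_of_neg_add_one H2).tsum_eq, h0, add_zero, add_comm (tsum _)]
  simpa only [sub_eq_add_neg] using hs2.hasSum.add hs1.neg.hasSum

lemma hasSum_bmat (j : ℕ) {x : ℝ} (hx : |x| < 1) :
    HasSum (fun k : ℕ => bmat j k * x ^ (2 * k + 1)) (Tsub 1 (fun t => t ^ (2 * j + 1)) x) := by
  set F : ℝ → ℕ → ℕ → ℝ := fun x n k => 2 * ((2 * j + 2 * k + 3).factorial : ℝ) /
        ((2 * j + 2).factorial * (2 * k + 1).factorial) * x ^ (2 * k + 1) *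
          ((2 * ((n : ℝ) + 1)) ^ (2 * j + 2 * k + 4))⁻¹ with hF
  have hrow : ∀ x : ℝ, |x| < 1 → ∀ n : ℕ, HasSum (F x n)
      (((2 * ((n : ℝ) + 1) - x) ^ (2 * j + 3))⁻¹ -
        ((2 * ((n : ℝ) + 1) + x) ^ (2 * j + 3))⁻¹) := fun x hx n =>
    hasSum_inv_sub_pow_sub_inv_add_pow j (by linarith [(n.cast_nonneg : (0 : ℝ) ≤ n)])
  have hsum : Summable fun p : ℕ × ℕ => F x p.1 p.2 := by
    have hx' : |(|x|)| < 1 := by rwa [abs_abs]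
    have : Summable fun p : ℕ × ℕ => F |x| p.1 p.2 := by
      rw [summable_prod_of_nonneg fun p => by simp only [hF, Pi.zero_apply]; positivity]
      refine ⟨fun n => (hrow _ hx' n).summable, ?_⟩
      simp_rw [fun n => (hrow _ hx' n).tsum_eq]
      exact (hasSum_Tsub_one_pow j hx').summable
    refine Summable.of_norm_bounded this fun p => ?_
    simp only [hF, norm_mul, norm_div, norm_pow, norm_inv, Real.norm_eq_abs, Nat.abs_cast]
    have hp : (0 : ℝ) < p.1 + 1 := by positivity
    rw [abs_two, abs_of_pos hp]
  have hcol : ∀ k, HasSum (fun n => F x n k) (bmat j k * x ^ (2 * k + 1)) := by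
    intro k
    have := (summable_inv_natCast_add_one_pow (m := 2 * j + 2 * k + 4) (by omega)).hasSum.mul_left
      (2 * ((2 * j + 2 * k + 3).factorial : ℝ) /
        ((2 * j + 2).factorial * (2 * k + 1).factorial) * x ^ (2 * k + 1) *
          (2 ^ (2 * j + 2 * k + 4))⁻¹)
    convert! this using 1
    · ext n
      simp only [hF, mul_pow, mul_inv]
      ring
    · rw [bmat, show 2 * j + 2 * k + 4 = (2 * j + 2 * k + 3) + 1 by ring, pow_succ (2 : ℝ)]
      field_simp
      ring
  have h1 := hsum.hasSum.prod_fiberwise fun n => hrow x hx n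
  rw [(hasSum_Tsub_one_pow j hx).unique h1]
  have h2 := (Equiv.prodComm ℕ ℕ).hasSum_iff.2 hsum.hasSum
  exact h2.prod_fiberwise hcol

/-- (i) `T₁ u_j(x) = ∑_k b_{j,k} x^{2k+1}` on `(-1,1)`, where `u_j(t) = t^{2j+1}`;
(ii) the matrix `(b_{j,k})` is strictly totally positive: every minor with strictly
increasing row and column indices has strictly positive determinant. -/
theorem bmat_expansion_and_strict_total_positivity :
    (∀ j : ℕ, ∀ x ∈ Ioo (-1 : ℝ) 1,
      HasSum (fun k : ℕ => bmat j k * x ^ (2 * k + 1))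
        (Tsub 1 (fun t => t ^ (2 * j + 1)) x)) ∧
    (∀ r : ℕ, 1 ≤ r → ∀ jj kk : Fin r → ℕ, StrictMono jj → StrictMono kk →
      0 < Matrix.det (Matrix.of fun s t : Fin r => bmat (jj s) (kk t))) := by
  exact ⟨fun j x hx => hasSum_bmat j (abs_lt.2 hx), fun _ _ jj kk hj hk => det_bmat_pos jj kk hj hk⟩
end
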